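/- arXiv:1412.1970 — 3 statements merged into one kernel-verified Lean document; each statement's English description precedes it below -/
import Mathlib

section
/- (Chain rule for Young integrals.) Let V, W be Banach spaces, 1 ≤ p < 2, let g : V → W be twice continuously differentiable and Z ∈ V^p([0,T],V). Then g ∘ Z ∈ V^p([0,T],W), Dg ∘ Z ∈ V^p([0,T],L(V,W)), and for all t ∈ [0,T] the Young integral ∫_0^t Dg(Z_r) dZ_r exists and g(Z_t) − g(Z_0) = ∫_0^t Dg(Z_r) dZ_r. -/
open Set Filter Topology

noncomputable section

/-- The `p`-variation of a path `X : ℝ → E` on the interval `[a,b]`,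
`‖X‖_{p,[a,b]} = (sup_D Σ_i ‖X_{t_{i+1}} − X_{t_i}‖^p)^(1/p)`, the supremum being taken
over all finite partitions `a = t₀ ≤ t₁ ≤ … ≤ t_k = b`. -/
def pVar {E : Type*} [NormedAddCommGroup E] (p : ℝ) (X : ℝ → E) (a b : ℝ) : ENNReal :=
  ⨆ (k : ℕ) (t : Fin (k + 1) → ℝ)
    (_ : Monotone t ∧ t 0 = a ∧ t (Fin.last k) = b),
    (∑ i : Fin k, (‖X (t i.succ) - X (t i.castSucc)‖₊ : ENNReal) ^ p) ^ (1 / p)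

/-- `X ∈ V^p([a,b],E)`: `X` is continuous on `[a,b]` and has finite `p`-variation there. -/
def MemVp {E : Type*} [NormedAddCommGroup E] (p : ℝ) (X : ℝ → E) (a b : ℝ) : Prop :=
  ContinuousOn X (Set.Icc a b) ∧ pVar p X a b < ⊤

/-- A partition `a = t₀ ≤ t₁ ≤ … ≤ t_k = b` of `[a,b]`. -/
structure YoungPartition (a b : ℝ) where
  k : ℕ
  t : Fin (k + 1) → ℝ
  mono : Monotone t
  first : t 0 = a
  last : t (Fin.last k) = b

/-- The mesh of a partition. -/
def YoungPartition.mesh {a b : ℝ} (D : YoungPartition a b) : ℝ :=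
  ⨆ i : Fin D.k, (D.t i.succ - D.t i.castSucc)

/-- The Riemann sum `Σ_i Z_{t_i}(X_{t_{i+1}} − X_{t_i})` along a partition. -/
def riemannSum {E F : Type*} [NormedAddCommGroup E] [NormedSpace ℝ E]
    [NormedAddCommGroup F] [NormedSpace ℝ F]
    (Z : ℝ → E →L[ℝ] F) (X : ℝ → E) {a b : ℝ} (D : YoungPartition a b) : F :=
  ∑ i : Fin D.k, Z (D.t i.castSucc) (X (D.t i.succ) - X (D.t i.castSucc))

/-- `IsYoungIntegral Z X a b I` : the Riemann sums of `Z` against `X` over partitions of `[a,b]`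
converge to `I` as the mesh tends to `0`; i.e. the Young integral `∫_a^b Z dX` exists and
equals `I`. -/
def IsYoungIntegral {E F : Type*} [NormedAddCommGroup E] [NormedSpace ℝ E]
    [NormedAddCommGroup F] [NormedSpace ℝ F]
    (Z : ℝ → E →L[ℝ] F) (X : ℝ → E) (a b : ℝ) (I : F) : Prop :=
  Filter.Tendsto (fun D : YoungPartition a b => riemannSum Z X D)
    (Filter.comap YoungPartition.mesh (nhds 0)) (nhds I)

/-- View a vector `v : E` as the continuous linear map `ℝ →L[ℝ] E`, `c ↦ c • v`; used to
integrate vector-valued integrands against scalar integrators. -/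
def toCLM {E : Type*} [NormedAddCommGroup E] [NormedSpace ℝ E] (v : E) : ℝ →L[ℝ] E :=
  (1 : ℝ →L[ℝ] ℝ).smulRight v

/-- The `α`-Hölder seminorm `‖X‖_{α;H} = sup_{s ≠ t ∈ [a,b]} ‖X_t − X_s‖ / |t−s|^α` of a path. -/
def holderSemiPath {E : Type*} [NormedAddCommGroup E] (α : ℝ) (X : ℝ → E) (a b : ℝ) : ENNReal :=
  ⨆ (s : Set.Icc a b) (t : Set.Icc a b) (_ : (s : ℝ) ≠ (t : ℝ)),
    (‖X (t : ℝ) - X (s : ℝ)‖₊ : ENNReal) / edist (s : ℝ) (t : ℝ) ^ α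

/-- The `α`-Hölder norm (sup norm plus Hölder seminorm) of a path on `[a,b]`. -/
def holderNormPath {E : Type*} [NormedAddCommGroup E] (α : ℝ) (X : ℝ → E) (a b : ℝ) : ENNReal :=
  (⨆ t : Set.Icc a b, (‖X (t : ℝ)‖₊ : ENNReal)) + holderSemiPath α X a b

/-- The `γ`-Hölder constant `‖f‖_{γ,H} = sup_{x ≠ y} ‖f x − f y‖ / ‖x − y‖^γ` of a map
between normed spaces. -/
def holderConst {E F : Type*} [NormedAddCommGroup E] [NormedAddCommGroup F]
    (γ : ℝ) (f : E → F) : ENNReal :=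
  ⨆ (x : E) (y : E) (_ : x ≠ y), (‖f x - f y‖₊ : ENNReal) / (‖x - y‖₊ : ENNReal) ^ γ


theorem YoungPartition.mem_Icc {a b : ℝ} (D : YoungPartition a b) (i : Fin (D.k + 1)) :
    D.t i ∈ Set.Icc a b :=
  ⟨D.first.symm.le.trans (D.mono (Fin.zero_le i)), (D.mono (Fin.le_last i)).trans D.last.le⟩

theorem YoungPartition.sub_le_mesh {a b : ℝ} (D : YoungPartition a b) (i : Fin D.k) :
    D.t i.succ - D.t i.castSucc ≤ D.mesh :=
  le_ciSup (f := fun i : Fin D.k => D.t i.succ - D.t i.castSucc)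
    (Set.finite_range _).bddAbove i

theorem Fin.sum_succ_sub_castSucc {M : Type*} [AddCommGroup M] :
    ∀ {n : ℕ} (f : Fin (n + 1) → M),
      ∑ i : Fin n, (f i.succ - f i.castSucc) = f (Fin.last n) - f 0
  | 0, f => by simp
  | n + 1, f => by
    rw [Fin.sum_univ_castSucc]
    have := Fin.sum_succ_sub_castSucc fun i : Fin (n + 1) => f i.castSucc
    simp only [Fin.succ_castSucc, this, Fin.succ_last, Fin.castSucc_zero]
    abel

/-- The points of a partition of `[a,b]` followed by one more point `c ≥ b`. -/
def YoungPartition.snoc {a b c : ℝ} (D : YoungPartition a b) (hbc : b ≤ c) :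
    YoungPartition a c where
  k := D.k + 1
  t := Fin.snoc (α := fun _ => ℝ) D.t c
  mono := by
    refine Fin.monotone_iff_le_succ.2 fun i => ?_
    refine Fin.lastCases ?_ (fun j => ?_) i
    · simpa [D.last] using hbc
    · rw [Fin.succ_castSucc, Fin.snoc_castSucc, Fin.snoc_castSucc]
      exact D.mono (Fin.castSucc_le_succ j)
  first := by
    rw [← Fin.castSucc_zero, Fin.snoc_castSucc, D.first]
  last := by simp

theorem YoungPartition.sum_rpow_le_pVar {E : Type*} [NormedAddCommGroup E] {p : ℝ} (hp : 0 < p)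
    (X : ℝ → E) {a b : ℝ} (D : YoungPartition a b) :
    ∑ i : Fin D.k, (‖X (D.t i.succ) - X (D.t i.castSucc)‖₊ : ENNReal) ^ p ≤ pVar p X a b ^ p := by
  rw [← ENNReal.rpow_inv_le_iff hp, ← one_div]
  exact le_iSup_of_le D.k (le_iSup₂_of_le D.t ⟨D.mono, D.first, D.last⟩ le_rfl)

theorem YoungPartition.sum_rpow_le_pVar_of_le {E : Type*} [NormedAddCommGroup E] {p : ℝ}
    (hp : 0 < p) (X : ℝ → E) {a b c : ℝ} (D : YoungPartition a b) (hbc : b ≤ c) :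
    ∑ i : Fin D.k, (‖X (D.t i.succ) - X (D.t i.castSucc)‖₊ : ENNReal) ^ p ≤ pVar p X a c ^ p := by
  refine le_trans ?_ ((D.snoc hbc).sum_rpow_le_pVar hp X)
  change _ ≤ ∑ i : Fin (D.k + 1), _
  rw [Fin.sum_univ_castSucc]
  refine le_trans (le_of_eq ?_) le_self_add
  refine Finset.sum_congr rfl fun i _ => ?_
  simp only [YoungPartition.snoc, Fin.succ_castSucc, Fin.snoc_castSucc]

theorem YoungPartition.sum_norm_rpow_le {E : Type*} [NormedAddCommGroup E] {p : ℝ}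
    (hp : 0 < p) {X : ℝ → E} {a b c : ℝ} (D : YoungPartition a b) (hbc : b ≤ c)
    (hX : pVar p X a c < ⊤) :
    ∑ i : Fin D.k, ‖X (D.t i.succ) - X (D.t i.castSucc)‖ ^ p ≤ (pVar p X a c ^ p).toReal := by
  have h := ENNReal.toReal_mono (ENNReal.rpow_ne_top_of_nonneg hp.le hX.ne)
    (D.sum_rpow_le_pVar_of_le hp X hbc)
  rw [ENNReal.toReal_sum fun i _ => ENNReal.rpow_ne_top_of_nonneg hp.le ENNReal.coe_ne_top] at h
  simpa [← ENNReal.toReal_rpow] using h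

theorem LipschitzOnWith.pVar_comp_le {E F : Type*} [NormedAddCommGroup E] [NormedAddCommGroup F]
    {K : NNReal} {h : E → F} {s : Set E} (hh : LipschitzOnWith K h s) {p : ℝ} (hp : 0 < p)
    {X : ℝ → E} {a b : ℝ} (hX : Set.MapsTo X (Set.Icc a b) s) :
    pVar p (fun t => h (X t)) a b ≤ K * pVar p X a b := by
  refine iSup_le fun k => iSup₂_le fun t ht => ?_
  let D : YoungPartition a b := ⟨k, t, ht.1, ht.2.1, ht.2.2⟩
  have key : ∑ i : Fin k, (‖h (X (t i.succ)) - h (X (t i.castSucc))‖₊ : ENNReal) ^ p ≤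
      (K * pVar p X a b) ^ p := by
    rw [ENNReal.mul_rpow_of_nonneg _ _ hp.le]
    refine le_trans ?_ (mul_le_mul_right (D.sum_rpow_le_pVar hp X) _)
    rw [Finset.mul_sum]
    refine Finset.sum_le_sum fun i _ => ?_
    rw [← ENNReal.mul_rpow_of_nonneg _ _ hp.le]
    refine ENNReal.rpow_le_rpow ?_ hp.le
    have := hh (hX (D.mem_Icc i.succ)) (hX (D.mem_Icc i.castSucc))
    rwa [edist_eq_enorm_sub, edist_eq_enorm_sub] at this
  rwa [one_div, ENNReal.rpow_inv_le_iff hp]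

theorem MemVp.comp_lipschitzOnWith {E F : Type*} [NormedAddCommGroup E] [NormedAddCommGroup F]
    {p : ℝ} (hp : 0 < p) {X : ℝ → E} {a b : ℝ} (hX : MemVp p X a b)
    {K : NNReal} {h : E → F} {s : Set E} (hh : LipschitzOnWith K h s)
    (hs : Set.MapsTo X (Set.Icc a b) s) :
    MemVp p (fun t => h (X t)) a b :=
  ⟨hh.continuousOn.comp hX.1 hs,
    (hh.pVar_comp_le hp hs).trans_lt (ENNReal.mul_lt_top ENNReal.coe_lt_top hX.2)⟩

theorem ContDiff.exists_lipschitzOnWith_of_isCompact {E F : Type*} [NormedAddCommGroup E]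
    [NormedSpace ℝ E] [NormedAddCommGroup F] [NormedSpace ℝ F] {f : E → F}
    (hf : ContDiff ℝ 1 f) {s : Set E} (hs : IsCompact s) (hconv : Convex ℝ s) :
    ∃ K : NNReal, LipschitzOnWith K f s := by
  obtain ⟨C, hC⟩ := hs.exists_bound_of_continuousOn (hf.continuous_fderiv one_ne_zero).continuousOn
  refine ⟨C.toNNReal, hconv.lipschitzOnWith_of_nnnorm_fderiv_le
    (fun x _ => hf.differentiable one_ne_zero x) fun x hx => ?_⟩
  exact NNReal.le_toNNReal_of_coe_le (hC x hx)

theorem norm_sub_sub_fderiv_le_of_lipschitzOnWith_fderiv {E F : Type*} [NormedAddCommGroup E]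
    [NormedSpace ℝ E] [NormedAddCommGroup F] [NormedSpace ℝ F] {f : E → F}
    (hf : Differentiable ℝ f) {s : Set E} (hconv : Convex ℝ s) {K : NNReal}
    (hK : LipschitzOnWith K (fderiv ℝ f) s) {x y : E} (hx : x ∈ s) (hy : y ∈ s) :
    ‖f y - f x - fderiv ℝ f x (y - x)‖ ≤ K * ‖y - x‖ ^ 2 := by
  have hseg := hconv.segment_subset hx hy
  have h := (convex_segment x y).norm_image_sub_le_of_norm_fderiv_le'
    (φ := fderiv ℝ f x) (C := K * ‖y - x‖) (fun z _ => hf z) (fun z hz => ?_)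
    (left_mem_segment ℝ x y) (right_mem_segment ℝ x y)
  · rwa [mul_assoc, ← sq] at h
  · refine (hK.norm_sub_le (hseg hz) hx).trans ?_
    gcongr
    exact norm_sub_le_of_mem_segment hz

theorem isYoungIntegral_fderiv_comp {V W : Type*} [NormedAddCommGroup V] [NormedSpace ℝ V]
    [NormedAddCommGroup W] [NormedSpace ℝ W] {p a b c : ℝ} (hp : 0 < p) (hp2 : p < 2)
    {g : V → W} (hg : Differentiable ℝ g) {s : Set V} (hconv : Convex ℝ s) {K : NNReal}
    (hK : LipschitzOnWith K (fderiv ℝ g) s) {Z : ℝ → V} (hZ : MemVp p Z a c)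
    (hs : Set.MapsTo Z (Set.Icc a c) s) (hbc : b ≤ c) :
    IsYoungIntegral (fun r => fderiv ℝ g (Z r)) Z a b (g (Z b) - g (Z a)) := by
  set C : ℝ := (pVar p Z a c ^ p).toReal
  refine Metric.tendsto_nhds.2 fun ε hε => ?_
  obtain ⟨η, hηε, hη⟩ : ∃ η : ℝ, K * η ^ (2 - p) * C < ε ∧ 0 < η := by
    have hcont : Continuous fun η : ℝ => K * η ^ (2 - p) * C :=
      (continuous_const.mul (Real.continuous_rpow_const (by linarith))).mul continuous_const
    have hlim := hcont.tendsto 0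
    rw [Real.zero_rpow (by linarith), mul_zero, zero_mul] at hlim
    exact (((hlim.mono_left nhdsWithin_le_nhds).eventually_lt_const hε).and
      (self_mem_nhdsWithin : Set.Ioi (0 : ℝ) ∈ 𝓝[>] 0)).exists
  obtain ⟨δ, hδ, hZδ⟩ := Metric.uniformContinuousOn_iff.1
    (isCompact_Icc.uniformContinuousOn_of_continuous hZ.1) η hη
  filter_upwards [Filter.preimage_mem_comap (Iio_mem_nhds hδ)] with D hD
  have hmem : ∀ i, D.t i ∈ Set.Icc a c := fun i =>
    Set.Icc_subset_Icc_right hbc (D.mem_Icc i)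
  have htel : g (Z b) - g (Z a) =
      ∑ i : Fin D.k, (g (Z (D.t i.succ)) - g (Z (D.t i.castSucc))) := by
    rw [Fin.sum_succ_sub_castSucc fun i => g (Z (D.t i)), D.first, D.last]
  rw [dist_comm, dist_eq_norm, htel, riemannSum, ← Finset.sum_sub_distrib]
  refine lt_of_le_of_lt ?_ hηε
  calc ‖∑ i : Fin D.k, (g (Z (D.t i.succ)) - g (Z (D.t i.castSucc)) -
          fderiv ℝ g (Z (D.t i.castSucc)) (Z (D.t i.succ) - Z (D.t i.castSucc)))‖
      ≤ ∑ i : Fin D.k, K * η ^ (2 - p) * ‖Z (D.t i.succ) - Z (D.t i.castSucc)‖ ^ p := by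
        refine norm_sum_le_of_le _ fun i _ => ?_
        refine (norm_sub_sub_fderiv_le_of_lipschitzOnWith_fderiv hg hconv hK
          (hs (hmem i.castSucc)) (hs (hmem i.succ))).trans ?_
        have hsmall : ‖Z (D.t i.succ) - Z (D.t i.castSucc)‖ ≤ η := by
          rw [← dist_eq_norm]
          refine (hZδ _ (hmem _) _ (hmem _) ?_).le
          rw [Real.dist_eq, abs_of_nonneg (sub_nonneg.2 (D.mono (Fin.castSucc_le_succ i)))]
          exact (D.sub_le_mesh i).trans_lt hD
        rw [mul_assoc]
        refine mul_le_mul_of_nonneg_left ?_ K.coe_nonneg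
        rw [← Real.rpow_natCast, show ((2 : ℕ) : ℝ) = (2 - p) + p by norm_num,
          Real.rpow_add_of_nonneg (norm_nonneg _) (by linarith) hp.le]
        gcongr
    _ ≤ K * η ^ (2 - p) * C := by
        rw [← Finset.mul_sum]
        gcongr
        exact D.sum_norm_rpow_le hp hbc hZ.2

/-- Chain rule for Young integrals: if `g : V → W` is twice continuously differentiable and
`Z ∈ V^p([0,T],V)` with `1 ≤ p < 2`, then `g ∘ Z ∈ V^p([0,T],W)`,
`Dg ∘ Z ∈ V^p([0,T],L(V,W))`, and `g(Z_t) − g(Z_0) = ∫_0^t Dg(Z_r) dZ_r` (Young integral,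
which exists). -/
theorem young_chain_rule
    {V W : Type*} [NormedAddCommGroup V] [NormedSpace ℝ V] [CompleteSpace V]
    [NormedAddCommGroup W] [NormedSpace ℝ W] [CompleteSpace W]
    (p T : ℝ) (hp1 : 1 ≤ p) (hp2 : p < 2) (hT : 0 ≤ T)
    (g : V → W) (hg : ContDiff ℝ 2 g)
    (Z : ℝ → V) (hZ : MemVp p Z 0 T) :
    MemVp p (fun t => g (Z t)) 0 T ∧
    MemVp p (fun t => fderiv ℝ g (Z t)) 0 T ∧
    ∀ t ∈ Set.Icc (0 : ℝ) T,
      IsYoungIntegral (fun r => fderiv ℝ g (Z r)) Z 0 t (g (Z t) - g (Z 0)) := by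
  have hp : 0 < p := by linarith
  set s : Set V := closure (convexHull ℝ (Z '' Set.Icc 0 T))
  have hcomp : IsCompact s := TotallyBounded.isCompact_of_isClosed
    (isCompact_Icc.image_of_continuousOn hZ.1).totallyBounded.convexHull.closure isClosed_closure
  have hconv : Convex ℝ s := (convex_convexHull ℝ _).closure
  have hmaps : Set.MapsTo Z (Set.Icc 0 T) s := fun t ht =>
    subset_closure (subset_convexHull ℝ _ (Set.mem_image_of_mem Z ht))
  obtain ⟨L, hL⟩ := (hg.of_le one_le_two).exists_lipschitzOnWith_of_isCompact hcomp hconv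
  obtain ⟨K, hK⟩ := (hg.fderiv_right (m := 1) (by norm_num)).exists_lipschitzOnWith_of_isCompact
    hcomp hconv
  exact ⟨hZ.comp_lipschitzOnWith hp hL hmaps, hZ.comp_lipschitzOnWith hp hK hmaps, fun t ht =>
    isYoungIntegral_fderiv_comp hp hp2 (hg.differentiable two_ne_zero) hconv hK hZ hmaps ht.2⟩
end
end

section
/- (Substitution formula for Young integrals.) Let V, W, U be Banach spaces and p, q, l ≥ 1 with 1/q > 1 − 1/p and 1/l > 1 − 1/p. Let Z ∈ V^p([0,T],V), f ∈ V^q([0,T],L(V,W)), g ∈ V^l([0,T],L(W,U)), and define Y_t = ∫_0^t f_r dZ_r (Young integral). Then for all 0 ≤ s ≤ t ≤ T, both Young integrals below exist and ∫_s^t g_r dY_r = ∫_s^t (g_r ∘ f_r) dZ_r. -/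
open Set Filter Topology

noncomputable section

/-- A nonnegative superadditive function of the subintervals of `[0,T]`. -/
structure IsControl (T : ℝ) (ω : ℝ → ℝ → ℝ) : Prop where
  nonneg : ∀ s t, 0 ≤ ω s t
  superadd : ∀ s u t, 0 ≤ s → s ≤ u → u ≤ t → t ≤ T → ω s u + ω u t ≤ ω s t

namespace IsControl

variable {T : ℝ} {ω ω' : ℝ → ℝ → ℝ}

theorem add (h : IsControl T ω) (h' : IsControl T ω') :
    IsControl T (fun s t => ω s t + ω' s t) where
  nonneg s t := add_nonneg (h.nonneg s t) (h'.nonneg s t)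
  superadd s u t h0 h1 h2 h3 := by
    linarith [h.superadd s u t h0 h1 h2 h3, h'.superadd s u t h0 h1 h2 h3]

theorem mono (h : IsControl T ω) {a s t b : ℝ} (ha : 0 ≤ a) (has : a ≤ s) (hst : s ≤ t)
    (htb : t ≤ b) (hb : b ≤ T) : ω s t ≤ ω a b := by
  linarith [h.superadd a s b ha has (hst.trans htb) hb,
    h.superadd s t b (ha.trans has) hst htb hb, h.nonneg a s, h.nonneg t b]

theorem sum_le (h : IsControl T ω) {u : ℕ → ℝ} (hu : Monotone u) (h0 : 0 ≤ u 0) (n : ℕ)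
    (hn : u n ≤ T) : ∑ i ∈ Finset.range n, ω (u i) (u (i + 1)) ≤ ω (u 0) (u n) := by
  induction n with
  | zero => simpa using h.nonneg _ _
  | succ n ih =>
    rw [Finset.sum_range_succ]
    linarith [ih ((hu n.le_succ).trans hn),
      h.superadd (u 0) (u n) (u (n + 1)) h0 (hu n.zero_le) (hu n.le_succ) hn]

end IsControl

/-- The supremum of `∑ i, ‖X (u (i + 1)) - X (u i)‖ ^ p` over monotone sequences `u` in `[s,t]`. -/
def powVar {E : Type*} [NormedAddCommGroup E] (p : ℝ) (X : ℝ → E) (s t : ℝ) : ENNReal :=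
  ⨆ x : ℕ × {u : ℕ → ℝ // Monotone u ∧ ∀ i, u i ∈ Set.Icc s t},
    ∑ i ∈ Finset.range x.1, (‖X (x.2.1 (i + 1)) - X (x.2.1 i)‖₊ : ENNReal) ^ p

section powVar

variable {E : Type*} [NormedAddCommGroup E] {p : ℝ} {X : ℝ → E}

theorem sum_le_powVar {s t : ℝ} {u : ℕ → ℝ} (hu : Monotone u) (hmem : ∀ i, u i ∈ Set.Icc s t)
    (n : ℕ) :
    ∑ i ∈ Finset.range n, (‖X (u (i + 1)) - X (u i)‖₊ : ENNReal) ^ p ≤ powVar p X s t :=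
  le_iSup (fun x : ℕ × {u : ℕ → ℝ // Monotone u ∧ ∀ i, u i ∈ Set.Icc s t} =>
    ∑ i ∈ Finset.range x.1, (‖X (x.2.1 (i + 1)) - X (x.2.1 i)‖₊ : ENNReal) ^ p) (n, ⟨u, hu, hmem⟩)

theorem nnnorm_sub_rpow_le_powVar {s t : ℝ} (hst : s ≤ t) :
    (‖X t - X s‖₊ : ENNReal) ^ p ≤ powVar p X s t := by
  have := sum_le_powVar (p := p) (X := X) (s := s) (t := t)
    (u := fun i => if i = 0 then s else t)
    (by
      intro i j hij
      by_cases hj : j = 0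
      · have hi : i = 0 := by omega
        simp [hi, hj]
      · by_cases hi : i = 0 <;> simp [hi, hj, hst])
    (by intro i; by_cases hi : i = 0 <;> simp [hi, hst]) 1
  simpa using this

theorem powVar_add_le {s m t : ℝ} (hsm : s ≤ m) (hmt : m ≤ t) :
    powVar p X s m + powVar p X m t ≤ powVar p X s t := by
  have : Nonempty (ℕ × {u : ℕ → ℝ // Monotone u ∧ ∀ i, u i ∈ Set.Icc s m}) :=
    ⟨0, fun _ => s, monotone_const, fun _ => ⟨le_rfl, hsm⟩⟩
  have : Nonempty (ℕ × {u : ℕ → ℝ // Monotone u ∧ ∀ i, u i ∈ Set.Icc m t}) :=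
    ⟨0, fun _ => m, monotone_const, fun _ => ⟨le_rfl, hmt⟩⟩
  unfold powVar
  refine ENNReal.iSup_add_iSup_le ?_
  rintro ⟨n, u, hu, hus⟩ ⟨k, v, hv, hvs⟩
  have hw : Monotone (fun i => if i ≤ n then u i else v (i - (n + 1))) := by
    intro i j hij
    by_cases hi : i ≤ n <;> by_cases hj : j ≤ n <;> simp only [hi, hj, if_true, if_false]
    · exact hu hij
    · exact (hus i).2.trans (hvs _).1
    · omega
    · exact hv (by omega)
  have key := sum_le_powVar (p := p) (X := X) (s := s) (t := t) hw
    (by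
      intro i
      by_cases hi : i ≤ n <;> simp only [hi, if_true, if_false]
      · exact ⟨(hus i).1, (hus i).2.trans hmt⟩
      · exact ⟨hsm.trans (hvs _).1, (hvs _).2⟩) (n + 1 + k)
  refine le_trans ?_ key
  rw [Finset.sum_range_add, Finset.sum_range_succ]
  refine add_le_add (le_trans (le_of_eq ?_) le_self_add) (le_of_eq ?_)
  · refine Finset.sum_congr rfl fun i hi => ?_
    have := Finset.mem_range.1 hi
    rw [if_pos (by omega), if_pos (by omega)]
  · refine Finset.sum_congr rfl fun i hi => ?_
    rw [if_neg (by omega), if_neg (by omega)]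
    rw [show n + 1 + i + 1 - (n + 1) = i + 1 by omega, show n + 1 + i - (n + 1) = i by omega]

theorem powVar_le_pVar_rpow {T s t : ℝ} (hp : 0 < p) (hs : 0 ≤ s) (ht : t ≤ T) :
    powVar p X s t ≤ pVar p X 0 T ^ p := by
  refine iSup_le ?_
  rintro ⟨n, u, hu, hus⟩
  have hT : s ≤ t := (hus 0).1.trans (hus 0).2
  let w : ℕ → ℝ := fun i => if i = 0 then 0 else if i = n + 2 then T else u (i - 1)
  have hmono : Monotone (fun i : Fin (n + 2 + 1) => w i) := by
    intro i j hij
    have hij' : (i : ℕ) ≤ j := hij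
    have hj := j.2
    simp only [w]
    have := hus ((i : ℕ) - 1)
    have := hus ((j : ℕ) - 1)
    simp only [Set.mem_Icc] at *
    split_ifs <;> first | linarith | omega | exact hu (by omega)
  have hle : (∑ i : Fin (n + 2), (‖X (w i.succ) - X (w i.castSucc)‖₊ : ENNReal) ^ p) ^ (1 / p)
      ≤ pVar p X 0 T :=
    le_iSup_of_le (n + 2) <| le_iSup_of_le (fun i => w i) <|
      le_iSup_of_le ⟨hmono, by simp [w], by simp [w]⟩ le_rfl
  have hle' := ENNReal.rpow_le_rpow hle hp.le
  rw [← ENNReal.rpow_mul, one_div_mul_cancel hp.ne', ENNReal.rpow_one] at hle'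
  refine le_trans ?_ hle'
  simp only [Fin.val_succ, Fin.val_castSucc]
  rw [Fin.sum_univ_eq_sum_range (fun i => (‖X (w (i + 1)) - X (w i)‖₊ : ENNReal) ^ p) (n + 2),
    Finset.sum_range_succ, Finset.sum_range_succ']
  refine le_trans (le_trans (le_of_eq ?_) le_self_add) le_self_add
  refine Finset.sum_congr rfl fun i hi => ?_
  have := Finset.mem_range.1 hi
  simp only [w]
  rw [if_neg (by omega), if_neg (by omega), if_neg (by omega), if_neg (by omega)]
  rfl

/-- A path of finite `p`-variation is dominated by a control. -/
theorem MemVp.exists_control {T : ℝ} (hp : 0 < p) (hX : MemVp p X 0 T) :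
    ∃ ω, IsControl T ω ∧ ∀ s t, 0 ≤ s → s ≤ t → t ≤ T → ‖X t - X s‖ ≤ ω s t ^ (1 / p) := by
  have hfin : ∀ s t, 0 ≤ s → t ≤ T → powVar p X s t ≠ ⊤ := fun s t hs ht =>
    ne_top_of_le_ne_top (ENNReal.rpow_ne_top_of_nonneg hp.le hX.2.ne)
      (powVar_le_pVar_rpow hp hs ht)
  refine ⟨fun s t => (powVar p X s t).toReal, ⟨fun _ _ => ENNReal.toReal_nonneg, ?_⟩, ?_⟩
  · intro s u t h0 h1 h2 h3
    rw [← ENNReal.toReal_add (hfin _ _ h0 (h2.trans h3)) (hfin _ _ (h0.trans h1) h3)]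
    exact ENNReal.toReal_mono (hfin _ _ h0 h3) (powVar_add_le h1 h2)
  · intro s t hs hst ht
    have h := ENNReal.toReal_mono (hfin s t hs ht)
      (nnnorm_sub_rpow_le_powVar (p := p) (X := X) hst)
    rw [← ENNReal.toReal_rpow] at h
    have h2 := Real.rpow_le_rpow (by positivity) h (by positivity : 0 ≤ 1 / p)
    rw [← Real.rpow_mul (by positivity), mul_one_div_cancel hp.ne', Real.rpow_one] at h2
    simpa using h2

end powVar

/-- A discrete sewing lemma. -/
theorem norm_sum_sub_le_of_superadditive {F : Type*} [NormedAddCommGroup F]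
    (A : ℕ → ℕ → F) (ω : ℕ → ℕ → ℝ) {K θ : ℝ} (N : ℕ) (hK : 0 ≤ K) (hθ : 1 < θ)
    (hA : ∀ i, A i i = 0) (hω : ∀ i j, 0 ≤ ω i j)
    (hsup : ∀ i j k, i ≤ j → j ≤ k → k ≤ N → ω i j + ω j k ≤ ω i k)
    (hδ : ∀ i j k, i ≤ j → j ≤ k → k ≤ N → ‖A i k - A i j - A j k‖ ≤ K * ω i k ^ θ)
    {i j : ℕ} (hij : i ≤ j) (hj : j ≤ N) :
    ‖∑ r ∈ Finset.Ico i j, A r (r + 1) - A i j‖ ≤ 2 / (1 - 2 ^ (1 - θ)) * (K * ω i j ^ θ) := by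
  have h2 : (2 : ℝ) ^ (1 - θ) < 1 := Real.rpow_lt_one_of_one_lt_of_neg (by norm_num) (by linarith)
  set C : ℝ := 2 / (1 - 2 ^ (1 - θ)) with hC
  have hCpos : 0 < C := div_pos (by norm_num) (by linarith)
  have hCeq : 2 ^ (1 - θ) * C + 2 = C := by
    have : (1 : ℝ) - 2 ^ (1 - θ) ≠ 0 := by linarith
    rw [hC]; field_simp; ring
  induction hn : j - i using Nat.strong_induction_on generalizing i j with
  | _ n ih =>
  have hB : 0 ≤ K * ω i j ^ θ := mul_nonneg hK (Real.rpow_nonneg (hω _ _) _)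
  rcases hij.eq_or_lt with rfl | hlt
  · simpa [hA] using mul_nonneg hCpos.le hB
  -- the last index up to which the control has at most half of its mass
  obtain ⟨m, him, hmj, hm1, hm2⟩ : ∃ m, i ≤ m ∧ m < j ∧ ω i m ≤ ω i j / 2 ∧
      ω (m + 1) j ≤ ω i j / 2 := by
    have hzero : ∀ r ≤ N, ω r r = 0 := fun r hr => by
      linarith [hsup r r r le_rfl le_rfl hr, hω r r]
    by_contra! hcon
    have hall : ∀ d, i + d ≤ j → ω i (i + d) ≤ ω i j / 2 := by
      intro d
      induction d with
      | zero => intro _; rw [add_zero, hzero i (by omega)]; linarith [hω i j]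
      | succ d ihd =>
        intro hd
        have := hcon (i + d) (by omega) (by omega) (ihd (by omega))
        have := hsup i (i + d + 1) j (by omega) (by omega) hj
        rw [← add_assoc]; linarith
    have h1 := hall (j - i) (by omega)
    rw [show i + (j - i) = j by omega] at h1
    have h3 := hcon (j - 1) (by omega) (by omega) (by
      have := hall (j - 1 - i) (by omega)
      rwa [show i + (j - 1 - i) = j - 1 by omega] at this)
    rw [show j - 1 + 1 = j by omega, hzero j hj] at h3
    linarith [hω i j]
  have hhalf : ∀ a, 0 ≤ a → a ≤ ω i j / 2 →
      C * (K * a ^ θ) ≤ C * (K * ω i j ^ θ) * (2 ^ (1 - θ) / 2) := by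
    intro a ha hle
    have h1 := Real.rpow_le_rpow ha hle (by linarith : 0 ≤ θ)
    rw [Real.div_rpow (hω _ _) (by norm_num)] at h1
    have h3 : (2 : ℝ) ^ (1 - θ) / 2 = 1 / 2 ^ θ := by
      rw [Real.rpow_sub (by norm_num), Real.rpow_one]; field_simp
    rw [h3]
    calc C * (K * a ^ θ) ≤ C * (K * (ω i j ^ θ / 2 ^ θ)) := by gcongr
      _ = _ := by ring
  have e1 := (ih (m - i) (by omega) him (by omega) rfl).trans (hhalf _ (hω _ _) hm1)
  have e2 := (ih (j - (m + 1)) (by omega) (by omega : m + 1 ≤ j) hj rfl).trans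
    (hhalf _ (hω _ _) hm2)
  have e3 := hδ i m j him (by omega) hj
  have e4 := hδ m (m + 1) j (by omega) (by omega) hj
  have e5 : K * ω m j ^ θ ≤ K * ω i j ^ θ := by
    have := hsup i m j him (by omega) hj
    have := hω i m
    have := hω m j
    gcongr
    linarith
  have hsplit : ∑ r ∈ Finset.Ico i j, A r (r + 1) - A i j =
      (∑ r ∈ Finset.Ico i m, A r (r + 1) - A i m) +
      (∑ r ∈ Finset.Ico (m + 1) j, A r (r + 1) - A (m + 1) j) -
      (A i j - A i m - A m j) - (A m j - A m (m + 1) - A (m + 1) j) := by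
    rw [← Finset.sum_Ico_consecutive _ him hmj.le, Finset.sum_eq_sum_Ico_succ_bot hmj]
    abel
  rw [hsplit]
  refine (norm_sub_le _ _).trans ?_
  refine (add_le_add_left ((norm_sub_le _ _).trans (add_le_add_left (norm_add_le _ _) _)) _).trans ?_
  have : C * (K * ω i j ^ θ) = (2 ^ (1 - θ) * C + 2) * (K * ω i j ^ θ) := by rw [hCeq]
  nlinarith

section seqSum

variable {E F : Type*} [NormedAddCommGroup E] [NormedSpace ℝ E]
  [NormedAddCommGroup F] [NormedSpace ℝ F]

/-- The Riemann sum of `h` against `Z` along the first `n` steps of a sequence `u`. -/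
def seqSum (h : ℝ → E →L[ℝ] F) (Z : ℝ → E) (u : ℕ → ℝ) (n : ℕ) : F :=
  ∑ i ∈ Finset.range n, h (u i) (Z (u (i + 1)) - Z (u i))

/-- `u 0 ≤ … ≤ u n` is a partition of `[a,b]` all of whose steps are smaller than `η`. -/
structure IsFinePartition (η a b : ℝ) (u : ℕ → ℝ) (n : ℕ) : Prop where
  mono : Monotone u
  first : u 0 = a
  last : u n = b
  lt : ∀ i < n, u (i + 1) - u i < η

theorem IsFinePartition.weaken {η η' a b : ℝ} {u : ℕ → ℝ} {n : ℕ}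
    (hu : IsFinePartition η a b u n) (h : η ≤ η') : IsFinePartition η' a b u n :=
  ⟨hu.mono, hu.first, hu.last, fun i hi => (hu.lt i hi).trans_le h⟩

theorem isYoungIntegral_iff {h : ℝ → E →L[ℝ] F} {Z : ℝ → E} {a b : ℝ} {I : F} :
    IsYoungIntegral h Z a b I ↔ ∀ ε > 0, ∃ η > 0, ∀ (n : ℕ) (u : ℕ → ℝ),
      IsFinePartition η a b u n → ‖seqSum h Z u n - I‖ < ε := by
  have hbasis := (Metric.nhds_basis_ball (x := (0 : ℝ))).comap
    (YoungPartition.mesh : YoungPartition a b → ℝ)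
  unfold IsYoungIntegral
  rw [hbasis.tendsto_iff Metric.nhds_basis_ball]
  refine forall₂_congr fun ε _ => ?_
  constructor
  · rintro ⟨η, hη, H⟩
    refine ⟨η / 2, by positivity, fun n u hu => ?_⟩
    let D : YoungPartition a b :=
      ⟨n, fun i => u i, fun i j hij => hu.mono hij, by simpa using hu.first, by simpa using hu.last⟩
    have h1 : D.mesh ≤ η / 2 := Real.iSup_le (fun i => (hu.lt i i.2).le) (by positivity)
    have h2 : 0 ≤ D.mesh :=
      Real.iSup_nonneg fun i => sub_nonneg.2 (D.mono i.castSucc_le_succ)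
    have h3 := H D (by
      simp only [Set.mem_preimage, Metric.mem_ball, dist_zero_right, Real.norm_eq_abs]
      rw [abs_of_nonneg h2]; linarith)
    rw [Metric.mem_ball, dist_eq_norm] at h3
    have hsum : riemannSum h Z D = seqSum h Z u n :=
      Fin.sum_univ_eq_sum_range (fun i => h (u i) (Z (u (i + 1)) - Z (u i))) n
    rwa [hsum] at h3
  · rintro ⟨η, hη, H⟩
    refine ⟨η, hη, fun D hD => ?_⟩
    let u : ℕ → ℝ := fun i => D.t ⟨min i D.k, by omega⟩
    have hcast : ∀ i : Fin D.k, u i = D.t i.castSucc := fun i => by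
      simp only [u]; congr 1; ext; simp
    have hsucc : ∀ i : Fin D.k, u (i + 1) = D.t i.succ := fun i => by
      simp only [u]; congr 1; ext; simp
    have hu : IsFinePartition η a b u D.k := by
      refine ⟨fun i j hij => D.mono ?_, ?_, ?_, fun i hi => ?_⟩
      · rw [Fin.mk_le_mk]; omega
      · exact Eq.trans (congrArg D.t (by ext; simp)) D.first
      · exact Eq.trans (congrArg D.t (by ext; simp)) D.last
      · have h1 := hcast ⟨i, hi⟩
        have h2 := hsucc ⟨i, hi⟩
        simp only at h1 h2
        rw [h1, h2]
        have h3 : D.t (Fin.succ ⟨i, hi⟩) - D.t (Fin.castSucc ⟨i, hi⟩) ≤ D.mesh :=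
          le_ciSup (f := fun i : Fin D.k => D.t i.succ - D.t i.castSucc)
            (Set.finite_range _).bddAbove ⟨i, hi⟩
        simp only [Set.mem_preimage, Metric.mem_ball, dist_zero_right, Real.norm_eq_abs] at hD
        exact h3.trans_lt ((le_abs_self _).trans_lt hD)
    have h4 := H _ _ hu
    rw [Metric.mem_ball, dist_eq_norm]
    have hsum : riemannSum h Z D = seqSum h Z u D.k := by
      unfold riemannSum seqSum
      rw [← Fin.sum_univ_eq_sum_range (fun i => h (u i) (Z (u (i + 1)) - Z (u i)))]
      exact Finset.sum_congr rfl fun i _ => by rw [hcast, hsucc]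
    rwa [hsum]

theorem exists_isFinePartition {η a b : ℝ} (hη : 0 < η) (hab : a ≤ b) :
    ∃ u n, IsFinePartition η a b u n := by
  obtain ⟨n, hn⟩ := exists_nat_gt ((b - a) / η)
  have hn0 : (0 : ℝ) < n := (div_nonneg (sub_nonneg.2 hab) hη.le).trans_lt hn
  refine ⟨fun i => a + i * ((b - a) / n), n, ?_, by simp, by field_simp; ring, fun i _ => ?_⟩
  · intro i j hij
    have : (i : ℝ) ≤ j := by exact_mod_cast hij
    have : 0 ≤ (b - a) / n := div_nonneg (sub_nonneg.2 hab) hn0.le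
    simp only
    gcongr
  · rw [div_lt_iff₀ hη] at hn
    have : (b - a) / n < η := by rw [div_lt_iff₀ hn0]; linarith
    push_cast
    linarith

theorem IsFinePartition.concat {η a b c : ℝ} {u v : ℕ → ℝ} {n m : ℕ}
    (hu : IsFinePartition η a b u n) (hv : IsFinePartition η b c v m)
    (h : ℝ → E →L[ℝ] F) (Z : ℝ → E) :
    ∃ w, IsFinePartition η a c w (n + m) ∧
      seqSum h Z w (n + m) = seqSum h Z u n + seqSum h Z v m := by
  let w : ℕ → ℝ := fun i => if i ≤ n then u i else v (i - n)
  have hw1 : ∀ i ≤ n, w i = u i := fun i hi => if_pos hi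
  have hw2 : ∀ i, w (n + i) = v i := fun i => by
    rcases Nat.eq_zero_or_pos i with rfl | hi
    · rw [add_zero, hw1 n le_rfl, hu.last, hv.first]
    · simp only [w]; rw [if_neg (by omega)]; congr 1; omega
  refine ⟨w, ⟨monotone_nat_of_le_succ fun i => ?_, ?_, ?_, fun i hi => ?_⟩, ?_⟩
  · rcases lt_or_ge i n with hi | hi
    · rw [hw1 i hi.le, hw1 _ hi]; exact hu.mono i.le_succ
    · obtain ⟨j, rfl⟩ := Nat.exists_eq_add_of_le hi
      rw [add_assoc, hw2, hw2]; exact hv.mono j.le_succ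
  · rw [hw1 0 n.zero_le, hu.first]
  · rw [hw2, hv.last]
  · rcases lt_or_ge i n with hi' | hi'
    · rw [hw1 i hi'.le, hw1 _ hi']; exact hu.lt i hi'
    · obtain ⟨j, rfl⟩ := Nat.exists_eq_add_of_le hi'
      rw [add_assoc, hw2, hw2]; exact hv.lt j (by omega)
  · unfold seqSum
    rw [Finset.sum_range_add]
    congr 1
    · refine Finset.sum_congr rfl fun i hi => ?_
      have := Finset.mem_range.1 hi
      rw [hw1 i this.le, hw1 _ this]
    · refine Finset.sum_congr rfl fun i _ => ?_
      rw [add_assoc, hw2, hw2]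

/-- The Young integral over `[b,c]` is the difference of those over `[a,c]` and `[a,b]`. -/
theorem IsYoungIntegral.sub {h : ℝ → E →L[ℝ] F} {Z : ℝ → E} {a b c : ℝ} {I J : F} (hab : a ≤ b)
    (hI : IsYoungIntegral h Z a b I) (hJ : IsYoungIntegral h Z a c J) :
    IsYoungIntegral h Z b c (J - I) := by
  rw [isYoungIntegral_iff] at *
  intro ε hε
  obtain ⟨η₁, hη₁, H₁⟩ := hI (ε / 2) (by positivity)
  obtain ⟨η₂, hη₂, H₂⟩ := hJ (ε / 2) (by positivity)
  refine ⟨min η₁ η₂, lt_min hη₁ hη₂, fun m v hv => ?_⟩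
  obtain ⟨u, n, hu⟩ := exists_isFinePartition (lt_min hη₁ hη₂) hab
  obtain ⟨w, hw, hsum⟩ := hu.concat hv h Z
  have h1 := H₁ _ _ (hu.weaken (min_le_left _ _))
  have h2 := H₂ _ _ (hw.weaken (min_le_right _ _))
  rw [hsum] at h2
  calc ‖seqSum h Z v m - (J - I)‖
      = ‖(seqSum h Z u n + seqSum h Z v m - J) - (seqSum h Z u n - I)‖ := by congr 1; abel
    _ ≤ _ := norm_sub_le _ _
    _ < ε := by linarith

/-- The Riemann sums of `h` against `Z` over partitions of short subintervals of `[0,T]` agree with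
the one-step approximation up to a small multiple of the control `ω`. -/
def IsLocallyApprox (T : ℝ) (ω : ℝ → ℝ → ℝ) (h : ℝ → E →L[ℝ] F) (Z : ℝ → E) : Prop :=
  ∀ ε > 0, ∃ η > 0, ∀ (n : ℕ) (u : ℕ → ℝ), Monotone u → 0 ≤ u 0 → u n ≤ T → u n - u 0 < η →
    ‖seqSum h Z u n - h (u 0) (Z (u n) - Z (u 0))‖ ≤ ε * ω (u 0) (u n)

theorem isLocallyApprox_of_control {T C α β : ℝ} {ω : ℝ → ℝ → ℝ} {h : ℝ → E →L[ℝ] F} {Z : ℝ → E}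
    (hω : IsControl T ω) (hC : 0 ≤ C) (hα : 0 < α) (hβ : 0 < β) (hβ1 : β ≤ 1) (hαβ : 1 < α + β)
    (hcont : ContinuousOn h (Set.Icc 0 T))
    (hh : ∀ s t, 0 ≤ s → s ≤ t → t ≤ T → ‖h t - h s‖ ≤ C * ω s t ^ α)
    (hZ : ∀ s t, 0 ≤ s → s ≤ t → t ≤ T → ‖Z t - Z s‖ ≤ ω s t ^ β) :
    IsLocallyApprox T ω h Z := by
  intro ε hε
  -- trade a part of the regularity of `h` for the smallness of its oscillation
  set μ : ℝ := (α + β - 1) / (2 * α) with hμ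
  set θ : ℝ := (α + β + 1) / 2 with hθ
  have hμ0 : 0 < μ := div_pos (by linarith) (by positivity)
  have hμ1 : 0 ≤ 1 - μ := by
    rw [sub_nonneg, hμ, div_le_one (by positivity)]; linarith
  have hθ1 : 1 < θ := by rw [hθ]; linarith
  have hθeq : α * (1 - μ) + β = θ := by rw [hμ, hθ]; field_simp; ring
  set M : ℝ := 2 / (1 - 2 ^ (1 - θ)) * (C ^ (1 - μ) * ω 0 T ^ (θ - 1)) with hM
  obtain ⟨δ, hδ, hδε⟩ : ∃ δ > 0, M * δ ^ μ ≤ ε := by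
    have hlim : Tendsto (fun δ : ℝ => M * δ ^ μ) (𝓝[>] 0) (𝓝 0) := by
      have : Tendsto (fun δ : ℝ => M * δ ^ μ) (𝓝 0) (𝓝 (M * 0 ^ μ)) :=
        ((Real.continuousAt_rpow_const 0 μ (Or.inr hμ0.le)).tendsto).const_mul M
      rw [Real.zero_rpow hμ0.ne', mul_zero] at this
      exact this.mono_left nhdsWithin_le_nhds
    obtain ⟨δ, h1, h2⟩ := ((hlim.eventually (gt_mem_nhds hε)).and self_mem_nhdsWithin).exists
    exact ⟨δ, h2, h1.le⟩
  obtain ⟨η, hη, H⟩ := Metric.uniformContinuousOn_iff.1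
    (isCompact_Icc.uniformContinuousOn_of_continuous hcont) δ hδ
  refine ⟨η, hη, fun n u hu h0 hn hlt => ?_⟩
  have hT : ∀ i ≤ n, u i ≤ T := fun i hi => (hu hi).trans hn
  have hp : ∀ i, 0 ≤ u i := fun i => h0.trans (hu i.zero_le)
  have key := norm_sum_sub_le_of_superadditive
    (fun i j => h (u i) (Z (u j) - Z (u i))) (fun i j => ω (u i) (u j))
    (K := δ ^ μ * C ^ (1 - μ)) n (by positivity) hθ1 (by simp) (fun _ _ => hω.nonneg _ _)
    (fun i j k hij hjk hk => hω.superadd _ _ _ (hp i) (hu hij) (hu hjk) (hT k hk))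
    (fun i j k hij hjk hk => by
      have hd : h (u i) (Z (u k) - Z (u i)) - h (u i) (Z (u j) - Z (u i)) -
          h (u j) (Z (u k) - Z (u j)) = -((h (u j) - h (u i)) (Z (u k) - Z (u j))) := by
        simp only [map_sub, sub_apply]; abel
      rw [hd, norm_neg]
      have hik := hω.nonneg (u i) (u k)
      have hj : j ≤ n := hjk.trans hk
      have e1 : ‖h (u j) - h (u i)‖ ≤ δ := by
        rw [← dist_eq_norm]
        refine (H _ ⟨hp j, hT j hj⟩ _ ⟨hp i, hT i (hij.trans hj)⟩ ?_).le
        rw [Real.dist_eq, abs_of_nonneg (sub_nonneg.2 (hu hij))]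
        linarith [hu hj, hu i.zero_le]
      have e2 : ‖h (u j) - h (u i)‖ ≤ C * ω (u i) (u k) ^ α := by
        refine (hh _ _ (hp i) (hu hij) (hT j hj)).trans ?_
        have := hω.mono (hp i) le_rfl (hu hij) (hu hjk) (hT k hk)
        have := hω.nonneg (u i) (u j)
        gcongr
      have e3 : ‖Z (u k) - Z (u j)‖ ≤ ω (u i) (u k) ^ β := by
        refine (hZ _ _ (hp j) (hu hjk) (hT k hk)).trans ?_
        have := hω.mono (hp i) (hu hij) (hu hjk) le_rfl (hT k hk)
        have := hω.nonneg (u j) (u k)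
        gcongr
      have e4 : ‖h (u j) - h (u i)‖ ≤ δ ^ μ * (C * ω (u i) (u k) ^ α) ^ (1 - μ) := by
        calc ‖h (u j) - h (u i)‖ = ‖h (u j) - h (u i)‖ ^ μ * ‖h (u j) - h (u i)‖ ^ (1 - μ) := by
              rw [← Real.rpow_add_of_nonneg (norm_nonneg _) hμ0.le hμ1]; simp
          _ ≤ _ := by gcongr
      calc ‖(h (u j) - h (u i)) (Z (u k) - Z (u j))‖
          ≤ ‖h (u j) - h (u i)‖ * ‖Z (u k) - Z (u j)‖ := ContinuousLinearMap.le_opNorm _ _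
        _ ≤ δ ^ μ * (C * ω (u i) (u k) ^ α) ^ (1 - μ) * ω (u i) (u k) ^ β := by gcongr
        _ = _ := by
          rw [Real.mul_rpow hC (by positivity), ← Real.rpow_mul hik, ← hθeq,
            Real.rpow_add_of_nonneg hik (by positivity) hβ.le]
          ring)
    n.zero_le le_rfl
  rw [← Finset.range_eq_Ico] at key
  refine key.trans ?_
  have hT0 : u 0 ≤ u n := hu n.zero_le
  have hω0 := hω.nonneg (u 0) (u n)
  have hωT : ω (u 0) (u n) ^ θ ≤ ω 0 T ^ (θ - 1) * ω (u 0) (u n) := by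
    calc ω (u 0) (u n) ^ θ = ω (u 0) (u n) ^ (θ - 1) * ω (u 0) (u n) ^ (1 : ℝ) := by
          rw [← Real.rpow_add_of_nonneg hω0 (by linarith) (by norm_num)]; congr 1; ring
      _ ≤ _ := by
        rw [Real.rpow_one]
        have := hω.mono le_rfl h0 hT0 hn le_rfl
        have : 0 ≤ θ - 1 := by linarith
        gcongr
  have h2 : (2 : ℝ) ^ (1 - θ) < 1 := Real.rpow_lt_one_of_one_lt_of_neg (by norm_num) (by linarith)
  have hc : 0 ≤ 2 / (1 - (2 : ℝ) ^ (1 - θ)) := div_nonneg (by norm_num) (by linarith)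
  calc 2 / (1 - (2 : ℝ) ^ (1 - θ)) * (δ ^ μ * C ^ (1 - μ) * ω (u 0) (u n) ^ θ)
      ≤ 2 / (1 - (2 : ℝ) ^ (1 - θ)) *
        (δ ^ μ * C ^ (1 - μ) * (ω 0 T ^ (θ - 1) * ω (u 0) (u n))) := by gcongr
    _ = M * δ ^ μ * ω (u 0) (u n) := by rw [hM]; ring
    _ ≤ ε * ω (u 0) (u n) := by gcongr

/-- The increments of two partitions restricted to the common part of a pair of steps. -/
theorem clamp_increment_comm (h : ℝ → E →L[ℝ] F) (Z : ℝ → E) {x x' y y' : ℝ} (hx : x ≤ x')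
    (hy : y ≤ y') :
    h (max x (min y x')) (Z (max x (min y' x')) - Z (max x (min y x'))) =
      h (max y (min x y')) (Z (max y (min x' y')) - Z (max y (min x y'))) := by
  rcases le_total y' x with h1 | h1
  · have e1 : max x (min y x') = x := max_eq_left ((min_le_left _ _).trans (hy.trans h1))
    have e2 : max x (min y' x') = x := max_eq_left ((min_le_left _ _).trans h1)
    have e3 : max y (min x y') = y' := by rw [min_eq_right h1, max_eq_right hy]
    have e4 : max y (min x' y') = y' := by rw [min_eq_right (h1.trans hx), max_eq_right hy]
    rw [e1, e2, e3, e4]; simp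
  rcases le_total x' y with h2 | h2
  · have e1 : max x (min y x') = x' := by rw [min_eq_right h2, max_eq_right hx]
    have e2 : max x (min y' x') = x' := by rw [min_eq_right (h2.trans hy), max_eq_right hx]
    have e3 : max y (min x y') = y := max_eq_left ((min_le_left _ _).trans (hx.trans h2))
    have e4 : max y (min x' y') = y := max_eq_left ((min_le_left _ _).trans h2)
    rw [e1, e2, e3, e4]; simp
  rw [min_eq_left h2, min_eq_left h1, max_comm y x, max_eq_right (le_min h1 hx),
    max_eq_right (le_min h2 hy), min_comm y' x']

theorem norm_sum_clamp_sub_le {T ε η a b : ℝ} {ω : ℝ → ℝ → ℝ} {h : ℝ → E →L[ℝ] F} {Z : ℝ → E}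
    (hω : IsControl T ω) (hε : 0 ≤ ε) (ha : 0 ≤ a) (hb : b ≤ T)
    (H : ∀ (n : ℕ) (u : ℕ → ℝ), Monotone u → 0 ≤ u 0 → u n ≤ T → u n - u 0 < η →
      ‖seqSum h Z u n - h (u 0) (Z (u n) - Z (u 0))‖ ≤ ε * ω (u 0) (u n))
    {u v : ℕ → ℝ} {n m : ℕ} (hu : IsFinePartition η a b u n) (hv : IsFinePartition η a b v m) :
    ‖∑ i ∈ Finset.range n, seqSum h Z (fun r => max (u i) (min (v r) (u (i + 1)))) m
      - seqSum h Z u n‖ ≤ ε * ω a b := by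
  have hsum := hω.sum_le hu.mono (hu.first ▸ ha) n (hu.last ▸ hb)
  rw [hu.first, hu.last] at hsum
  refine le_trans ?_ (mul_le_mul_of_nonneg_left hsum hε)
  rw [Finset.mul_sum, seqSum, ← Finset.sum_sub_distrib]
  refine norm_sum_le_of_le _ fun i hi => ?_
  have hi := Finset.mem_range.1 hi
  have hstep := hu.mono i.le_succ
  have h0 : a ≤ u i := hu.first ▸ hu.mono i.zero_le
  have h1 : u (i + 1) ≤ b := hu.last ▸ hu.mono hi
  have e0 : max (u i) (min (v 0) (u (i + 1))) = u i := by
    rw [hv.first]; exact max_eq_left ((min_le_left _ _).trans h0)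
  have em : max (u i) (min (v m) (u (i + 1))) = u (i + 1) := by
    rw [hv.last, min_eq_right h1, max_eq_right hstep]
  have key := H m (fun r => max (u i) (min (v r) (u (i + 1))))
    (fun r r' hr => max_le_max le_rfl (min_le_min (hv.mono hr) le_rfl))
  simp only [e0, em] at key
  exact key (ha.trans h0) (h1.trans hb) (hu.lt i hi)

theorem norm_seqSum_sub_seqSum_le {T ε η a b : ℝ} {ω : ℝ → ℝ → ℝ} {h : ℝ → E →L[ℝ] F} {Z : ℝ → E}
    (hω : IsControl T ω) (hε : 0 ≤ ε) (ha : 0 ≤ a) (hb : b ≤ T)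
    (H : ∀ (n : ℕ) (u : ℕ → ℝ), Monotone u → 0 ≤ u 0 → u n ≤ T → u n - u 0 < η →
      ‖seqSum h Z u n - h (u 0) (Z (u n) - Z (u 0))‖ ≤ ε * ω (u 0) (u n))
    {u v : ℕ → ℝ} {n m : ℕ} (hu : IsFinePartition η a b u n) (hv : IsFinePartition η a b v m) :
    ‖seqSum h Z u n - seqSum h Z v m‖ ≤ 2 * (ε * ω a b) := by
  have h1 := norm_sum_clamp_sub_le hω hε ha hb H hu hv
  have h2 := norm_sum_clamp_sub_le hω hε ha hb H hv hu
  have hswap : ∑ i ∈ Finset.range n, seqSum h Z (fun r => max (u i) (min (v r) (u (i + 1)))) m =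
      ∑ r ∈ Finset.range m, seqSum h Z (fun i => max (v r) (min (u i) (v (r + 1)))) n := by
    unfold seqSum
    rw [Finset.sum_comm]
    exact Finset.sum_congr rfl fun r _ => Finset.sum_congr rfl fun i _ =>
      clamp_increment_comm h Z (hu.mono i.le_succ) (hv.mono r.le_succ)
  rw [hswap] at h1
  set S := ∑ r ∈ Finset.range m, seqSum h Z (fun i => max (v r) (min (u i) (v (r + 1)))) n
  calc ‖seqSum h Z u n - seqSum h Z v m‖
      = ‖(S - seqSum h Z v m) - (S - seqSum h Z u n)‖ := by congr 1; abel
    _ ≤ _ := norm_sub_le _ _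
    _ ≤ _ := by linarith

/-- Existence of the Young integral. -/
theorem IsLocallyApprox.exists_isYoungIntegral [CompleteSpace F] {T a b : ℝ} {ω : ℝ → ℝ → ℝ}
    {h : ℝ → E →L[ℝ] F} {Z : ℝ → E} (hω : IsControl T ω) (hloc : IsLocallyApprox T ω h Z)
    (ha : 0 ≤ a) (hab : a ≤ b) (hb : b ≤ T) : ∃ I, IsYoungIntegral h Z a b I := by
  have hcauchy : ∀ ε > 0, ∃ η > 0, ∀ (u v : ℕ → ℝ) (n m : ℕ), IsFinePartition η a b u n →
      IsFinePartition η a b v m → ‖seqSum h Z u n - seqSum h Z v m‖ < ε := by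
    intro ε hε
    have hω0 := hω.nonneg a b
    obtain ⟨η, hη, H⟩ := hloc (ε / (4 * (ω a b + 1))) (by positivity)
    refine ⟨η, hη, fun u v n m hu hv =>
      (norm_seqSum_sub_seqSum_le hω (by positivity) ha hb H hu hv).trans_lt ?_⟩
    have : ε / (4 * (ω a b + 1)) * ω a b = ε / 4 * (ω a b / (ω a b + 1)) := by field_simp
    have : ω a b / (ω a b + 1) ≤ 1 := by rw [div_le_one (by positivity)]; linarith
    nlinarith
  choose u n hun using fun k : ℕ =>
    exists_isFinePartition (η := 1 / ((k : ℝ) + 1)) (by positivity) hab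
  have hfine : ∀ η > 0, ∃ N, ∀ k ≥ N, IsFinePartition η a b (u k) (n k) := by
    intro η hη
    obtain ⟨N, hN⟩ := exists_nat_one_div_lt hη
    exact ⟨N, fun k hk => (hun k).weaken ((Nat.one_div_le_one_div hk).trans hN.le)⟩
  have hseq : CauchySeq fun k => seqSum h Z (u k) (n k) := by
    refine Metric.cauchySeq_iff.2 fun ε hε => ?_
    obtain ⟨η, hη, H⟩ := hcauchy ε hε
    obtain ⟨N, hN⟩ := hfine η hη
    exact ⟨N, fun k hk j hj => by rw [dist_eq_norm]; exact H _ _ _ _ (hN k hk) (hN j hj)⟩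
  obtain ⟨I, hI⟩ := cauchySeq_tendsto_of_complete hseq
  refine ⟨I, isYoungIntegral_iff.2 fun ε hε => ?_⟩
  obtain ⟨η, hη, H⟩ := hcauchy (ε / 2) (by positivity)
  refine ⟨η, hη, fun m v hv => ?_⟩
  obtain ⟨N, hN⟩ := hfine η hη
  obtain ⟨N', hN'⟩ := Metric.tendsto_atTop.1 hI (ε / 2) (by positivity)
  have h1 := H _ _ _ _ hv (hN _ (le_max_left N N'))
  have h2 := hN' _ (le_max_right N N')
  rw [dist_eq_norm] at h2
  exact (norm_sub_le_norm_sub_add_norm_sub _ _ _).trans_lt (by linarith)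

/-- The increments of an indefinite Young integral are close to the one-step approximation. -/
theorem IsLocallyApprox.norm_integral_sub_le {T : ℝ} {ω : ℝ → ℝ → ℝ} {h : ℝ → E →L[ℝ] F}
    {Z : ℝ → E} {Y : ℝ → F} (hloc : IsLocallyApprox T ω h Z)
    (hY : ∀ t ∈ Set.Icc (0 : ℝ) T, IsYoungIntegral h Z 0 t (Y t)) {ε : ℝ} (hε : 0 < ε) :
    ∃ η > 0, ∀ s t, 0 ≤ s → s ≤ t → t ≤ T → t - s < η →
      ‖Y t - Y s - h s (Z t - Z s)‖ ≤ ε * ω s t := by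
  obtain ⟨η, hη, H⟩ := hloc ε hε
  refine ⟨η, hη, fun s t hs hst ht hlt => le_of_forall_pos_le_add fun ε' hε' => ?_⟩
  obtain ⟨η', hη', H'⟩ := isYoungIntegral_iff.1
    ((hY s ⟨hs, hst.trans ht⟩).sub hs (hY t ⟨hs.trans hst, ht⟩)) ε' hε'
  obtain ⟨u, n, hu⟩ := exists_isFinePartition hη' hst
  have h1 := H' n u hu
  have h2 := H n u hu.mono
  rw [hu.first, hu.last] at h2
  have h2 := h2 hs ht hlt
  rw [norm_sub_rev] at h1
  exact (norm_sub_le_norm_sub_add_norm_sub _ _ _).trans (by linarith)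

end seqSum

/-- Associativity of integration at the level of Riemann sums. -/
theorem IsYoungIntegral.of_comp {V W U : Type*} [NormedAddCommGroup V] [NormedSpace ℝ V]
    [NormedAddCommGroup W] [NormedSpace ℝ W] [NormedAddCommGroup U] [NormedSpace ℝ U]
    {T M s t : ℝ} {ω : ℝ → ℝ → ℝ} {Z : ℝ → V} {f : ℝ → V →L[ℝ] W} {g : ℝ → W →L[ℝ] U}
    {Y : ℝ → W} {I : U} (hω : IsControl T ω) (hloc : IsLocallyApprox T ω f Z)
    (hY : ∀ t ∈ Set.Icc (0 : ℝ) T, IsYoungIntegral f Z 0 t (Y t))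
    (hg : ∀ r ∈ Set.Icc (0 : ℝ) T, ‖g r‖ ≤ M) (hs : 0 ≤ s) (hst : s ≤ t) (ht : t ≤ T)
    (hI : IsYoungIntegral (fun r => (g r).comp (f r)) Z s t I) : IsYoungIntegral g Y s t I := by
  rw [isYoungIntegral_iff] at hI ⊢
  intro ε hε
  have hM : 0 ≤ M := (norm_nonneg _).trans (hg s ⟨hs, hst.trans ht⟩)
  have hω0 := hω.nonneg s t
  obtain ⟨η₁, hη₁, H₁⟩ := hI (ε / 2) (by positivity)
  obtain ⟨η₂, hη₂, H₂⟩ := hloc.norm_integral_sub_le hY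
    (ε := ε / (2 * ((M + 1) * (ω s t + 1)))) (by positivity)
  refine ⟨min η₁ η₂, lt_min hη₁ hη₂, fun n u hu => ?_⟩
  have h1 := H₁ n u (hu.weaken (min_le_left _ _))
  have hsum := hω.sum_le hu.mono (hu.first ▸ hs) n (hu.last ▸ ht)
  rw [hu.first, hu.last] at hsum
  have h2 : ‖seqSum g Y u n - seqSum (fun r => (g r).comp (f r)) Z u n‖ ≤
      M * (ε / (2 * ((M + 1) * (ω s t + 1))) * ω s t) := by
    refine le_trans ?_ (mul_le_mul_of_nonneg_left
      (mul_le_mul_of_nonneg_left hsum (by positivity)) hM)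
    rw [Finset.mul_sum, Finset.mul_sum, seqSum, seqSum, ← Finset.sum_sub_distrib]
    refine norm_sum_le_of_le _ fun i hi => ?_
    have hi := Finset.mem_range.1 hi
    have h0 : 0 ≤ u i := hs.trans (hu.first ▸ hu.mono i.zero_le)
    have hT : u (i + 1) ≤ T := le_trans (hu.last ▸ hu.mono hi) ht
    have hstep := hu.mono i.le_succ
    rw [ContinuousLinearMap.comp_apply, ← map_sub]
    refine (ContinuousLinearMap.le_opNorm _ _).trans ?_
    exact mul_le_mul (hg _ ⟨h0, hstep.trans hT⟩)
      (H₂ _ _ h0 hstep hT ((hu.lt i hi).trans_le (min_le_right _ _))) (norm_nonneg _) hM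
  have h3 : M * (ε / (2 * ((M + 1) * (ω s t + 1))) * ω s t) ≤ ε / 2 := by
    have e : M * (ε / (2 * ((M + 1) * (ω s t + 1))) * ω s t) =
        ε / 2 * ((M / (M + 1)) * (ω s t / (ω s t + 1))) := by field_simp
    have e1 : M / (M + 1) ≤ 1 := by rw [div_le_one (by positivity)]; linarith
    have e2 : ω s t / (ω s t + 1) ≤ 1 := by rw [div_le_one (by positivity)]; linarith
    rw [e]
    exact mul_le_of_le_one_right (by positivity) (mul_le_one₀ e1 (by positivity) e2)
  exact (norm_sub_le_norm_sub_add_norm_sub _ _ _).trans_lt (add_lt_add_of_le_of_lt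
    (h2.trans h3) h1 |>.trans_eq (add_halves ε))

theorem Real.rpow_le_rpow_sub_mul {x y α β : ℝ} (hx : 0 ≤ x) (hxy : x ≤ y) (hα : 0 ≤ α)
    (hαβ : α ≤ β) : x ^ β ≤ y ^ (β - α) * x ^ α := by
  have h : 0 ≤ β - α := sub_nonneg.2 hαβ
  calc x ^ β = x ^ (β - α) * x ^ α := by
        rw [← Real.rpow_add_of_nonneg hx h hα, sub_add_cancel]
    _ ≤ _ := by gcongr

/-- The composition of two operator-valued paths controlled by `ω` is controlled by `ω`. -/
theorem norm_comp_sub_comp_le {V W U : Type*} [NormedAddCommGroup V] [NormedSpace ℝ V]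
    [NormedAddCommGroup W] [NormedSpace ℝ W] [NormedAddCommGroup U] [NormedSpace ℝ U]
    {T M N α β : ℝ} {ω : ℝ → ℝ → ℝ} {f : ℝ → V →L[ℝ] W} {g : ℝ → W →L[ℝ] U}
    (hω : IsControl T ω) (hα : 0 ≤ α) (hβ : 0 ≤ β)
    (hfN : ∀ r ∈ Set.Icc (0 : ℝ) T, ‖f r‖ ≤ N) (hgM : ∀ r ∈ Set.Icc (0 : ℝ) T, ‖g r‖ ≤ M)
    (hf : ∀ s t, 0 ≤ s → s ≤ t → t ≤ T → ‖f t - f s‖ ≤ ω s t ^ α)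
    (hg : ∀ s t, 0 ≤ s → s ≤ t → t ≤ T → ‖g t - g s‖ ≤ ω s t ^ β)
    {s t : ℝ} (hs : 0 ≤ s) (hst : s ≤ t) (ht : t ≤ T) :
    ‖(g t).comp (f t) - (g s).comp (f s)‖ ≤
      (M * ω 0 T ^ (α - min α β) + ω 0 T ^ (β - min α β) * N) * ω s t ^ min α β := by
  have hM : 0 ≤ M := (norm_nonneg _).trans (hgM s ⟨hs, hst.trans ht⟩)
  have hN : 0 ≤ N := (norm_nonneg _).trans (hfN s ⟨hs, hst.trans ht⟩)
  have hω0 := hω.nonneg s t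
  have hωT := hω.nonneg 0 T
  have hle := hω.mono le_rfl hs hst ht le_rfl
  have e1 := (hf s t hs hst ht).trans
    (Real.rpow_le_rpow_sub_mul hω0 hle (le_min hα hβ) (min_le_left α β))
  have e2 := (hg s t hs hst ht).trans
    (Real.rpow_le_rpow_sub_mul hω0 hle (le_min hα hβ) (min_le_right α β))
  have hd : (g t).comp (f t) - (g s).comp (f s) =
      (g t).comp (f t - f s) + (g t - g s).comp (f s) := by
    rw [ContinuousLinearMap.comp_sub, ContinuousLinearMap.sub_comp]; abel
  rw [hd]
  calc _ ≤ ‖g t‖ * ‖f t - f s‖ + ‖g t - g s‖ * ‖f s‖ :=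
        (norm_add_le _ _).trans (add_le_add (ContinuousLinearMap.opNorm_comp_le _ _)
          (ContinuousLinearMap.opNorm_comp_le _ _))
    _ ≤ M * (ω 0 T ^ (α - min α β) * ω s t ^ min α β) +
        (ω 0 T ^ (β - min α β) * ω s t ^ min α β) * N := by
      gcongr
      · exact hgM t ⟨hs.trans hst, ht⟩
      · exact hfN s ⟨hs, hst.trans ht⟩
    _ = _ := by ring

/-- Substitution formula for Young integrals: if `Z ∈ V^p`, `f ∈ V^q([0,T],L(V,W))`,
`g ∈ V^l([0,T],L(W,U))` with `1/q > 1 − 1/p`, `1/l > 1 − 1/p`, and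
`Y_t = ∫_0^t f_r dZ_r`, then `∫_s^t g_r dY_r = ∫_s^t (g_r ∘ f_r) dZ_r` for all
`0 ≤ s ≤ t ≤ T`, both Young integrals existing. -/
theorem young_substitution
    {V W U : Type*} [NormedAddCommGroup V] [NormedSpace ℝ V] [CompleteSpace V]
    [NormedAddCommGroup W] [NormedSpace ℝ W] [CompleteSpace W]
    [NormedAddCommGroup U] [NormedSpace ℝ U] [CompleteSpace U]
    (p q l T : ℝ) (hp : 1 ≤ p) (hq : 1 ≤ q) (hl : 1 ≤ l)
    (hpq : 1 / q > 1 - 1 / p) (hpl : 1 / l > 1 - 1 / p) (hT : 0 ≤ T)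
    (Z : ℝ → V) (hZ : MemVp p Z 0 T)
    (f : ℝ → V →L[ℝ] W) (hf : MemVp q f 0 T)
    (g : ℝ → W →L[ℝ] U) (hg : MemVp l g 0 T)
    (Y : ℝ → W) (hY : ∀ t ∈ Set.Icc (0 : ℝ) T, IsYoungIntegral f Z 0 t (Y t)) :
    ∀ s t : ℝ, 0 ≤ s → s ≤ t → t ≤ T →
      ∃ I : U, IsYoungIntegral g Y s t I ∧
        IsYoungIntegral (fun r => (g r).comp (f r)) Z s t I := by
  obtain ⟨ωZ, hωZ, hZω⟩ := hZ.exists_control (by linarith)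
  obtain ⟨ωf, hωf, hfω⟩ := hf.exists_control (by linarith)
  obtain ⟨ωg, hωg, hgω⟩ := hg.exists_control (by linarith)
  have hω := (hωZ.add hωf).add hωg
  set ω : ℝ → ℝ → ℝ := fun s t => ωZ s t + ωf s t + ωg s t with hωdef
  have hp0 : 0 < 1 / p := by positivity
  have hq0 : 0 < 1 / q := by positivity
  have hl0 : 0 < 1 / l := by positivity
  have hp1 : 1 / p ≤ 1 := by rw [div_le_one (by linarith)]; exact hp
  have hZ' : ∀ s t, 0 ≤ s → s ≤ t → t ≤ T → ‖Z t - Z s‖ ≤ ω s t ^ (1 / p) :=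
    fun s t h0 h1 h2 => (hZω s t h0 h1 h2).trans (Real.rpow_le_rpow (hωZ.nonneg s t)
      (by simp only [hωdef]; linarith [hωf.nonneg s t, hωg.nonneg s t]) hp0.le)
  have hf' : ∀ s t, 0 ≤ s → s ≤ t → t ≤ T → ‖f t - f s‖ ≤ ω s t ^ (1 / q) :=
    fun s t h0 h1 h2 => (hfω s t h0 h1 h2).trans (Real.rpow_le_rpow (hωf.nonneg s t)
      (by simp only [hωdef]; linarith [hωZ.nonneg s t, hωg.nonneg s t]) hq0.le)
  have hg' : ∀ s t, 0 ≤ s → s ≤ t → t ≤ T → ‖g t - g s‖ ≤ ω s t ^ (1 / l) :=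
    fun s t h0 h1 h2 => (hgω s t h0 h1 h2).trans (Real.rpow_le_rpow (hωg.nonneg s t)
      (by simp only [hωdef]; linarith [hωZ.nonneg s t, hωf.nonneg s t]) hl0.le)
  obtain ⟨N, hN⟩ := isCompact_Icc.exists_bound_of_continuousOn hf.1
  obtain ⟨M, hM⟩ := isCompact_Icc.exists_bound_of_continuousOn hg.1
  have hN0 : 0 ≤ N := (norm_nonneg _).trans (hN 0 ⟨le_rfl, hT⟩)
  have hM0 : 0 ≤ M := (norm_nonneg _).trans (hM 0 ⟨le_rfl, hT⟩)
  have hωT := hω.nonneg 0 T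
  have hlocf : IsLocallyApprox T ω f Z :=
    isLocallyApprox_of_control hω zero_le_one hq0 hp0 hp1 (by linarith) hf.1
      (by simpa only [one_mul] using hf') hZ'
  have hlocgf : IsLocallyApprox T ω (fun r => (g r).comp (f r)) Z :=
    isLocallyApprox_of_control hω (by positivity) (lt_min hq0 hl0) hp0 hp1
      (by rcases min_choice (1 / q) (1 / l) with h | h <;> rw [h] <;> linarith)
      (hg.1.clm_comp hf.1)
      (fun s t h0 h1 h2 => norm_comp_sub_comp_le hω hq0.le hl0.le hN hM hf' hg' h0 h1 h2) hZ'
  intro s t hs hst ht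
  obtain ⟨I, hI⟩ := hlocgf.exists_isYoungIntegral hω hs hst ht
  exact ⟨I, hI.of_comp hω hlocf hY hM hs hst ht, hI⟩
end
end

section
/- Let E₁, E₂, E₃ be Banach spaces, 1 ≤ p < 2, X ∈ V^p([0,T],E₂), and f : E₁ → L(E₂,E₁) γ-Hölder with 1 + γ > p. Let F : E₁ → E₃ be twice continuously differentiable with DF(y)(f(y)(e)) = 0 for all y ∈ E₁ and e ∈ E₂ (i.e. DF·f = 0). Then F is a conserved quantity of the Young equation dY = f(Y)dX: for every solution Y of dY = f(Y)dX, F(Y_t) = F(Y_0) for all t ∈ [0,T]. -/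
open Set Filter Topology

noncomputable section

/-- `Y` is a solution on `[0,T]` of the Young equation `dY = Σ_{i=1}^n f_i(Y) dX^i`
starting at `y₀`, where `f_i(y) = f(y)(e_i)` for the standard basis `e_i` of `ℝ^n` and
`X^i` are the coordinates of `X`: `Y ∈ V^p([0,T],E₁)` and
`Y_t = y₀ + Σ_i ∫_0^t f_i(Y_s) dX^i_s` (Young integrals). -/
def IsYoungSolution {n : ℕ} {E₁ : Type*} [NormedAddCommGroup E₁] [NormedSpace ℝ E₁]
    (p T : ℝ) (X : ℝ → Fin n → ℝ) (f : E₁ → (Fin n → ℝ) →L[ℝ] E₁)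
    (y₀ : E₁) (Y : ℝ → E₁) : Prop :=
  Y 0 = y₀ ∧ MemVp p Y 0 T ∧
  ∀ t ∈ Set.Icc (0 : ℝ) T, ∃ I : Fin n → E₁,
    (∀ i, IsYoungIntegral (fun s => toCLM (f (Y s) (Pi.single i 1)))
      (fun s => X s i) 0 t (I i)) ∧
    Y t = y₀ + ∑ i, I i

theorem exists_control_of_memVp {E : Type*} [NormedAddCommGroup E] {p T : ℝ} (hp : 0 < p)
    {X : ℝ → E} (hX : MemVp p X 0 T) :
    ∃ V : ℝ → ℝ, ∀ a b, 0 ≤ a → a ≤ b → b ≤ T → ‖X b - X a‖ ^ p ≤ V b - V a := by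
  have step : ∀ a b, 0 ≤ a → a ≤ b →
      pVar p X 0 a ^ p + (‖X b - X a‖₊ : ENNReal) ^ p ≤ pVar p X 0 b ^ p := by
    intro a b ha hab
    have key : pVar p X 0 a ≤
        (pVar p X 0 b ^ p - (‖X b - X a‖₊ : ENNReal) ^ p) ^ (1 / p) := by
      refine iSup_le fun k => iSup_le fun t => iSup_le fun ⟨hm, h0, hl⟩ => ?_
      refine ENNReal.rpow_le_rpow ?_ (by positivity)
      refine ENNReal.le_sub_of_add_le_right
        (ENNReal.rpow_ne_top_of_nonneg hp.le ENNReal.coe_ne_top) ?_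
      rw [← ENNReal.rpow_inv_le_iff hp, ← one_div]
      refine le_trans ?_ (le_iSup_of_le (k + 1) (le_iSup_of_le (Fin.snoc t b : Fin (k + 2) → ℝ)
        (le_iSup_of_le ⟨?_, ?_, ?_⟩ le_rfl)))
      · refine le_of_eq ?_
        rw [Fin.sum_univ_castSucc]
        congr 2
        · refine Finset.sum_congr rfl fun i _ => ?_
          rw [Fin.succ_castSucc, Fin.snoc_castSucc, Fin.snoc_castSucc]
        · rw [Fin.succ_last, Fin.snoc_last, Fin.snoc_castSucc, hl]
      · rw [Fin.monotone_iff_le_succ]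
        intro i
        refine Fin.lastCases ?_ (fun j => ?_) i
        · rw [Fin.succ_last, Fin.snoc_last, Fin.snoc_castSucc, hl]
          exact hab
        · rw [Fin.succ_castSucc, Fin.snoc_castSucc, Fin.snoc_castSucc]
          exact hm (Fin.castSucc_le_succ j)
      · rw [← Fin.castSucc_zero, Fin.snoc_castSucc, h0]
      · rw [Fin.snoc_last]
    have hle : (‖X b - X a‖₊ : ENNReal) ^ p ≤ pVar p X 0 b ^ p := by
      rw [← ENNReal.rpow_inv_le_iff hp, ← one_div]
      refine le_trans ?_ (le_iSup_of_le 2 (le_iSup_of_le (![0, a, b] : Fin 3 → ℝ)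
        (le_iSup_of_le ⟨?_, rfl, rfl⟩ le_rfl)))
      · refine ENNReal.rpow_le_rpow ?_ (by positivity)
        rw [Fin.sum_univ_two]
        exact le_add_self
      · rw [Fin.monotone_iff_le_succ]
        intro i
        fin_cases i
        · exact ha
        · exact hab
    rw [one_div, ENNReal.le_rpow_inv_iff hp] at key
    calc _ ≤ _ := add_le_add_left key _
      _ = _ := tsub_add_cancel_of_le hle
  have fin : ∀ b, 0 ≤ b → b ≤ T → pVar p X 0 b ^ p ≠ ⊤ := fun b hb hbT =>
    ne_top_of_le_ne_top (ENNReal.rpow_ne_top_of_nonneg hp.le hX.2.ne)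
      (le_self_add.trans (step b T hb hbT))
  refine ⟨fun b => (pVar p X 0 b ^ p).toReal, fun a b ha hab hb => ?_⟩
  have h := ENNReal.toReal_mono (fin b (ha.trans hab) hb) (step a b ha hab)
  rw [ENNReal.toReal_add (fin a ha (hab.trans hb))
    (ENNReal.rpow_ne_top_of_nonneg hp.le ENNReal.coe_ne_top),
    ← ENNReal.toReal_rpow (‖X b - X a‖₊ : ENNReal)] at h
  rw [ENNReal.coe_toReal, coe_nnnorm] at h
  linarith

theorem exists_index_halving {V : ℕ → ℝ} {m n : ℕ} (hmn : m < n) (hV : V m ≤ V n) :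
    ∃ i, m ≤ i ∧ i < n ∧ V i - V m ≤ (V n - V m) / 2 ∧
      V n - V (i + 1) ≤ (V n - V m) / 2 := by
  classical
  have hex : ∃ j, m < j ∧ (n ≤ j ∨ (V n - V m) / 2 < V j - V m) := ⟨n, hmn, Or.inl le_rfl⟩
  obtain ⟨i, hi⟩ : ∃ i, Nat.find hex = i + 1 :=
    Nat.exists_eq_succ_of_ne_zero (by have := (Nat.find_spec hex).1; omega)
  have hs := Nat.find_spec hex
  have hmin := Nat.find_min hex (m := i) (by omega)
  rw [hi] at hs
  have hle : Nat.find hex ≤ n := Nat.find_min' hex ⟨hmn, Or.inl le_rfl⟩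
  refine ⟨i, by omega, by omega, ?_, ?_⟩
  · rcases eq_or_lt_of_le (show m ≤ i by omega) with rfl | h
    · linarith
    · by_contra hcon
      exact hmin ⟨h, Or.inr (not_le.mp hcon)⟩
  · rcases hs.2 with h | h
    · have : i + 1 = n := by omega
      rw [this]
      linarith
    · linarith

/-- Discrete sewing lemma with an additive control. -/
theorem norm_sum_sub_le_of_almost_additive {E : Type*} [NormedAddCommGroup E]
    {V : ℕ → ℝ} {Ξ : ℕ → ℕ → E} {a b : ℕ} {θ K C : ℝ} (hθ : 0 < θ) (hK : 0 ≤ K) (hC : 0 ≤ C)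
    (hCθ : 2 * (C * (1 / 2) ^ θ) + 2 ≤ C)
    (hV : ∀ i j, a ≤ i → i ≤ j → j ≤ b → V i ≤ V j)
    (hΞ : ∀ i j k, a ≤ i → i ≤ j → j ≤ k → k ≤ b →
      ‖Ξ i k - Ξ i j - Ξ j k‖ ≤ K * (V k - V i) ^ θ)
    (m n : ℕ) (ham : a ≤ m) (hmn : m ≤ n) (hnb : n ≤ b) :
    ‖∑ l ∈ Finset.Ico m n, Ξ l (l + 1) - Ξ m n‖ ≤ C * K * (V n - V m) ^ θ := by
  induction hd : n - m using Nat.strong_induction_on generalizing m n with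
  | _ d ih =>
    rcases eq_or_lt_of_le hmn with rfl | hlt
    · have := hΞ m m m ham le_rfl le_rfl hnb
      simpa [Real.zero_rpow hθ.ne'] using this
    obtain ⟨i, hmi, hin, h1, h2⟩ := exists_index_halving hlt (hV m n ham hmn hnb)
    have hmi0 := hV m i ham hmi (by omega)
    have hin0 := hV (i + 1) n (by omega) (by omega) hnb
    have hmn0 := hV m n ham hmn hnb
    have hin1 := hV i n (by omega) (by omega) hnb
    have b1 := ih (i - m) (by omega) m i ham hmi (by omega) rfl
    have b2 := ih (n - (i + 1)) (by omega) (i + 1) n (by omega) (by omega) hnb rfl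
    have b3 := hΞ m i n ham hmi (by omega) hnb
    have b4 := hΞ i (i + 1) n (by omega) (by omega) (by omega) hnb
    have half : ∀ w, 0 ≤ w → w ≤ (V n - V m) / 2 →
        w ^ θ ≤ (1 / 2) ^ θ * (V n - V m) ^ θ := by
      intro w hw hw2
      rw [← Real.mul_rpow (by norm_num) (by linarith)]
      exact Real.rpow_le_rpow hw (by linarith) hθ.le
    have c1 : C * K * (V i - V m) ^ θ ≤ C * K * ((1 / 2) ^ θ * (V n - V m) ^ θ) :=
      mul_le_mul_of_nonneg_left (half _ (by linarith) h1) (by positivity)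
    have c2 : C * K * (V n - V (i + 1)) ^ θ ≤ C * K * ((1 / 2) ^ θ * (V n - V m) ^ θ) :=
      mul_le_mul_of_nonneg_left (half _ (by linarith) h2) (by positivity)
    have c4 : K * (V n - V i) ^ θ ≤ K * (V n - V m) ^ θ :=
      mul_le_mul_of_nonneg_left (Real.rpow_le_rpow (by linarith) (by linarith) hθ.le) hK
    have hsplit : ∑ l ∈ Finset.Ico m n, Ξ l (l + 1) =
        ∑ l ∈ Finset.Ico m i, Ξ l (l + 1) + Ξ i (i + 1) +
          ∑ l ∈ Finset.Ico (i + 1) n, Ξ l (l + 1) := by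
      rw [← Finset.sum_Ico_succ_top hmi, Finset.sum_Ico_consecutive _ (by omega) (by omega)]
    have hdec : ∑ l ∈ Finset.Ico m n, Ξ l (l + 1) - Ξ m n =
        (∑ l ∈ Finset.Ico m i, Ξ l (l + 1) - Ξ m i) +
        (∑ l ∈ Finset.Ico (i + 1) n, Ξ l (l + 1) - Ξ (i + 1) n) -
        (Ξ m n - Ξ m i - Ξ i n) - (Ξ i n - Ξ i (i + 1) - Ξ (i + 1) n) := by
      rw [hsplit]; abel
    have hfin := mul_le_mul_of_nonneg_right hCθ
      (mul_nonneg hK (Real.rpow_nonneg (sub_nonneg.mpr hmn0) θ))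
    rw [hdec]
    refine (norm_sub_le _ _).trans ?_
    refine (add_le_add_left ((norm_sub_le _ _).trans
      (add_le_add_left (norm_add_le _ _) _)) _).trans ?_
    linarith

/-- The partition of `[a,b]` given by the first `n + 1` terms of a monotone sequence. -/
def YoungPartition.ofMonotone {a b : ℝ} (t : ℕ → ℝ) (n : ℕ) (ht : Monotone t)
    (h0 : t 0 = a) (hn : t n = b) : YoungPartition a b where
  k := n
  t i := t i
  mono _ _ h := ht h
  first := by simpa using h0
  last := by simpa using hn

theorem riemannSum_ofMonotone {E F : Type*} [NormedAddCommGroup E] [NormedSpace ℝ E]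
    [NormedAddCommGroup F] [NormedSpace ℝ F] (Z : ℝ → E →L[ℝ] F) (X : ℝ → E) {a b : ℝ}
    (t : ℕ → ℝ) (n : ℕ) (ht : Monotone t) (h0 : t 0 = a) (hn : t n = b) :
    riemannSum Z X (YoungPartition.ofMonotone t n ht h0 hn) =
      ∑ l ∈ Finset.range n, Z (t l) (X (t (l + 1)) - X (t l)) := by
  rw [← Fin.sum_univ_eq_sum_range (fun l => Z (t l) (X (t (l + 1)) - X (t l)))]
  rfl

theorem IsYoungIntegral.tendsto_sum_range {E F : Type*} [NormedAddCommGroup E]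
    [NormedSpace ℝ E] [NormedAddCommGroup F] [NormedSpace ℝ F] {Z : ℝ → E →L[ℝ] F}
    {X : ℝ → E} {a b : ℝ} {I : F} (h : IsYoungIntegral Z X a b I)
    {t : ℕ → ℕ → ℝ} {N : ℕ → ℕ} {δ : ℕ → ℝ} (ht : ∀ m, Monotone (t m))
    (h0 : ∀ m, t m 0 = a) (hN : ∀ m, t m (N m) = b)
    (hδ : ∀ m i, t m (i + 1) - t m i ≤ δ m) (hδ0 : Tendsto δ atTop (𝓝 0)) :
    Tendsto (fun m => ∑ l ∈ Finset.range (N m), Z (t m l) (X (t m (l + 1)) - X (t m l)))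
      atTop (𝓝 I) := by
  have hlim : Tendsto (fun m => YoungPartition.ofMonotone (t m) (N m) (ht m) (h0 m) (hN m))
      atTop (comap YoungPartition.mesh (𝓝 0)) := by
    rw [tendsto_comap_iff]
    refine squeeze_zero (fun m => Real.iSup_nonneg fun i => sub_nonneg.mpr ?_)
      (fun m => Real.iSup_le (fun i => hδ m i) ?_) hδ0
    · exact ht m (Nat.le_succ _)
    · exact (sub_nonneg.mpr (ht m (Nat.le_succ 0))).trans (hδ m 0)
  have := Tendsto.comp h hlim
  simpa only [Function.comp_def, riemannSum_ofMonotone] using this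

/-- A point moving from `0` to `u` in `m` equal steps, then from `u` to `v` in `m` equal steps. -/
def twoPhasePoint (u v : ℝ) (m i : ℕ) : ℝ :=
  u * min ((i : ℝ) / m) 1 + (v - u) * min (max ((i : ℝ) / m - 1) 0) 1

section TwoPhase

variable {u v : ℝ}

theorem twoPhasePoint_monotone (hu : 0 ≤ u) (huv : u ≤ v) (m : ℕ) :
    Monotone (twoPhasePoint u v m) := by
  intro i j hij
  have h : (i : ℝ) / m ≤ (j : ℝ) / m := by gcongr
  have huv' : 0 ≤ v - u := sub_nonneg.mpr huv
  unfold twoPhasePoint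
  gcongr

theorem twoPhasePoint_zero (m : ℕ) : twoPhasePoint u v m 0 = 0 := by
  simp [twoPhasePoint]

theorem twoPhasePoint_self {m : ℕ} (hm : 0 < m) : twoPhasePoint u v m m = u := by
  have : (m : ℝ) ≠ 0 := by positivity
  simp [twoPhasePoint, this]

theorem twoPhasePoint_two_mul {m : ℕ} (hm : 0 < m) : twoPhasePoint u v m (2 * m) = v := by
  have : (m : ℝ) ≠ 0 := by positivity
  have h2 : ((2 * m : ℕ) : ℝ) / m = 2 := by push_cast; field_simp
  rw [twoPhasePoint, h2]
  norm_num

theorem twoPhasePoint_succ_sub_le (hu : 0 ≤ u) (huv : u ≤ v) (m i : ℕ) :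
    twoPhasePoint u v m (i + 1) - twoPhasePoint u v m i ≤ v / m := by
  have hs : ((i + 1 : ℕ) : ℝ) / m = (i : ℝ) / m + 1 / m := by push_cast; ring
  have hm : (0 : ℝ) ≤ 1 / m := by positivity
  have h1 : min (((i + 1 : ℕ) : ℝ) / m) 1 - min ((i : ℝ) / m) 1 ≤ 1 / m := by
    rw [hs]
    grind
  have h2 : min (max (((i + 1 : ℕ) : ℝ) / m - 1) 0) 1 - min (max ((i : ℝ) / m - 1) 0) 1
      ≤ 1 / m := by
    rw [hs]
    grind
  have e1 := mul_le_mul_of_nonneg_left h1 hu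
  have e2 := mul_le_mul_of_nonneg_left h2 (sub_nonneg.mpr huv)
  have e3 : v / m = u * (1 / m) + (v - u) * (1 / m) := by ring
  unfold twoPhasePoint
  rw [e3]
  linarith

end TwoPhase

/-- A uniform bound for the Riemann sums over all monotone sequences running from `u` to `v`
passes to the increment over `[u,v]` of the indefinite Young integral. -/
theorem norm_sub_sub_le_of_riemannSum_bound {E F : Type*} [NormedAddCommGroup E]
    [NormedSpace ℝ E] [NormedAddCommGroup F] [NormedSpace ℝ F] {Z : ℝ → E →L[ℝ] F}
    {X : ℝ → E} {u v B : ℝ} {I J R : F} (hu : 0 ≤ u) (huv : u ≤ v)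
    (hI : IsYoungIntegral Z X 0 u I) (hJ : IsYoungIntegral Z X 0 v J)
    (hB : ∀ (t : ℕ → ℝ) (m n : ℕ), Monotone t → m ≤ n → t m = u → t n = v →
      ‖∑ l ∈ Finset.Ico m n, Z (t l) (X (t (l + 1)) - X (t l)) - R‖ ≤ B) :
    ‖J - I - R‖ ≤ B := by
  have hδ0 : Tendsto (fun m : ℕ => v / ((m + 1 : ℕ) : ℝ)) atTop (𝓝 0) :=
    (tendsto_const_div_atTop_nhds_zero_nat v).comp (tendsto_add_atTop_nat 1)
  have lI := hI.tendsto_sum_range (t := fun m => twoPhasePoint u v (m + 1))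
    (N := fun m => m + 1) (fun m => twoPhasePoint_monotone hu huv _)
    (fun m => twoPhasePoint_zero _) (fun m => twoPhasePoint_self m.succ_pos)
    (fun m i => twoPhasePoint_succ_sub_le hu huv _ i) hδ0
  have lJ := hJ.tendsto_sum_range (t := fun m => twoPhasePoint u v (m + 1))
    (N := fun m => 2 * (m + 1)) (fun m => twoPhasePoint_monotone hu huv _)
    (fun m => twoPhasePoint_zero _) (fun m => twoPhasePoint_two_mul m.succ_pos)
    (fun m i => twoPhasePoint_succ_sub_le hu huv _ i) hδ0
  refine le_of_tendsto ((lJ.sub lI).sub_const R).norm (Eventually.of_forall fun m => ?_)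
  rw [← Finset.sum_Ico_eq_sub _ (show m + 1 ≤ 2 * (m + 1) by omega)]
  exact hB _ _ _ (twoPhasePoint_monotone hu huv _) (by omega)
    (twoPhasePoint_self m.succ_pos) (twoPhasePoint_two_mul m.succ_pos)

theorem ContDiff.exists_taylor_bound_on_compact {E F : Type*} [NormedAddCommGroup E]
    [NormedSpace ℝ E] [CompleteSpace E] [NormedAddCommGroup F] [NormedSpace ℝ F] {g : E → F}
    (hg : ContDiff ℝ 2 g) {K : Set E} (hK : IsCompact K) :
    ∃ L M : ℝ, 0 ≤ L ∧ 0 ≤ M ∧ ∀ x ∈ K, ‖fderiv ℝ g x‖ ≤ M ∧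
      ∀ y ∈ K, ‖g y - g x - fderiv ℝ g x (y - x)‖ ≤ L * ‖y - x‖ ^ 2 := by
  set S := closure (convexHull ℝ K)
  have hSc : IsCompact S :=
    hK.totallyBounded.convexHull.closure.isCompact_of_isClosed isClosed_closure
  have hSconv : Convex ℝ S := (convex_convexHull ℝ K).closure
  have hKS : K ⊆ S := (subset_convexHull ℝ K).trans subset_closure
  have hg1 : ContDiff ℝ 1 (fderiv ℝ g) := hg.fderiv_right (by norm_num)
  obtain ⟨M, hM⟩ := hSc.exists_bound_of_continuousOn hg1.continuous.continuousOn
  obtain ⟨L, hL⟩ := hSc.exists_bound_of_continuousOn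
    (hg1.continuous_fderiv one_ne_zero).continuousOn
  refine ⟨max L 0, max M 0, le_max_right _ _, le_max_right _ _,
    fun x hx => ⟨(hM x (hKS hx)).trans (le_max_left _ _), fun y hy => ?_⟩⟩
  have hseg : segment ℝ x y ⊆ S := hSconv.segment_subset (hKS hx) (hKS hy)
  have := (convex_segment x y).norm_image_sub_le_of_norm_fderiv_le' (𝕜 := ℝ) (f := g)
    (φ := fderiv ℝ g x) (C := max L 0 * ‖y - x‖)
    (fun z _ => hg.differentiable two_ne_zero z) (fun z hz => ?_)
    (left_mem_segment ℝ x y) (right_mem_segment ℝ x y)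
  · rwa [pow_two, ← mul_assoc]
  · refine (hSconv.norm_image_sub_le_of_norm_fderiv_le (𝕜 := ℝ)
      (fun w _ => hg1.differentiable one_ne_zero w)
      (fun w hw => (hL w hw).trans (le_max_left L 0)) (hKS hx) (hseg hz)).trans ?_
    refine mul_le_mul_of_nonneg_left ?_ (le_max_right _ _)
    exact norm_sub_le_of_mem_segment hz

theorem rpow_le_rpow_div_of_rpow_le {x W p s : ℝ} (hx : 0 ≤ x) (hp : 0 < p) (hs : 0 ≤ s)
    (h : x ^ p ≤ W) : x ^ s ≤ W ^ (s / p) := by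
  calc x ^ s = (x ^ p) ^ (s / p) := by
        rw [← Real.rpow_mul hx, mul_div_cancel₀ _ hp.ne']
    _ ≤ W ^ (s / p) := Real.rpow_le_rpow (Real.rpow_nonneg hx _) h (by positivity)

/-- Young's inequality: local expansion of a solution with a gain in the oscillation. -/
theorem norm_increment_sub_le {E₁ E₂ : Type*} [NormedAddCommGroup E₁] [NormedSpace ℝ E₁]
    [NormedAddCommGroup E₂] [NormedSpace ℝ E₂] {p γ ε θ K C η u v : ℝ} (hp : 0 < p)
    (hε : 0 ≤ ε) (hεγ : ε ≤ γ) (hθ : θ = (1 + γ - ε) / p) (hK : 0 ≤ K) (hC : 0 ≤ C)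
    (hCθ : 2 * (C * (1 / 2) ^ θ) + 2 ≤ C) {X : ℝ → E₂} {Y : ℝ → E₁} {f : E₁ → E₂ →L[ℝ] E₁}
    (hf : ∀ x y, ‖f x - f y‖ ≤ K * ‖x - y‖ ^ γ) {V : ℝ → ℝ} (hu : 0 ≤ u) (huv : u ≤ v)
    (hVX : ∀ a b, u ≤ a → a ≤ b → b ≤ v → ‖X b - X a‖ ^ p ≤ V b - V a)
    (hVY : ∀ a b, u ≤ a → a ≤ b → b ≤ v → ‖Y b - Y a‖ ^ p ≤ V b - V a)
    (hη : ∀ a b, u ≤ a → a ≤ b → b ≤ v → ‖Y b - Y a‖ ≤ η)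
    (hYu : IsYoungIntegral (fun s => f (Y s)) X 0 u (Y u - Y 0))
    (hYv : IsYoungIntegral (fun s => f (Y s)) X 0 v (Y v - Y 0)) :
    ‖Y v - Y u - f (Y u) (X v - X u)‖ ≤ C * (K * η ^ ε) * (V v - V u) ^ θ := by
  have hη0 : 0 ≤ η := (norm_nonneg _).trans (hη u u le_rfl le_rfl huv)
  have hθ0 : 0 < θ := by rw [hθ]; apply div_pos <;> linarith
  have hVm : ∀ a b, u ≤ a → a ≤ b → b ≤ v → V a ≤ V b := fun a b ha hab hb =>
    sub_nonneg.mp ((Real.rpow_nonneg (norm_nonneg _) _).trans (hVX a b ha hab hb))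
  have defect : ∀ a b c, u ≤ a → a ≤ b → b ≤ c → c ≤ v →
      ‖f (Y a) (X c - X a) - f (Y a) (X b - X a) - f (Y b) (X c - X b)‖ ≤
        K * η ^ ε * (V c - V a) ^ θ := by
    intro a b c ha hab hbc hc
    have hW : 0 ≤ V c - V a := sub_nonneg.mpr (hVm a c ha (hab.trans hbc) hc)
    have e : f (Y a) (X c - X a) - f (Y a) (X b - X a) - f (Y b) (X c - X b) =
        -((f (Y b) - f (Y a)) (X c - X b)) := by
      simp only [map_sub, _root_.sub_apply]
      abel
    have hx : ‖X c - X b‖ ≤ (V c - V a) ^ (1 / p) := by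
      have := rpow_le_rpow_div_of_rpow_le (s := 1) (norm_nonneg (X c - X b)) hp zero_le_one
        ((hVX b c (ha.trans hab) hbc hc).trans
          (sub_le_sub_left (hVm a b ha hab (hbc.trans hc)) _))
      rwa [Real.rpow_one] at this
    have hy : ‖Y b - Y a‖ ^ γ ≤ η ^ ε * (V c - V a) ^ ((γ - ε) / p) := by
      have h1 := rpow_le_rpow_div_of_rpow_le (s := γ - ε) (norm_nonneg (Y b - Y a)) hp
        (sub_nonneg.mpr hεγ) ((hVY a b ha hab (hbc.trans hc)).trans
          (sub_le_sub_right (hVm b c (ha.trans hab) hbc hc) _))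
      have h2 := Real.rpow_le_rpow (norm_nonneg _) (hη a b ha hab (hbc.trans hc)) hε
      calc ‖Y b - Y a‖ ^ γ = ‖Y b - Y a‖ ^ ε * ‖Y b - Y a‖ ^ (γ - ε) := by
            rw [← Real.rpow_add_of_nonneg (norm_nonneg _) hε (sub_nonneg.mpr hεγ)]
            congr 1
            ring
        _ ≤ _ := by gcongr
    rw [e, norm_neg]
    calc ‖(f (Y b) - f (Y a)) (X c - X b)‖ ≤ ‖f (Y b) - f (Y a)‖ * ‖X c - X b‖ :=
          ContinuousLinearMap.le_opNorm _ _
      _ ≤ (K * (η ^ ε * (V c - V a) ^ ((γ - ε) / p))) * (V c - V a) ^ (1 / p) := by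
          gcongr
          exact (hf _ _).trans (by gcongr)
      _ = K * η ^ ε * ((V c - V a) ^ ((γ - ε) / p) * (V c - V a) ^ (1 / p)) := by ring
      _ = K * η ^ ε * (V c - V a) ^ θ := by
          rw [← Real.rpow_add_of_nonneg hW (div_nonneg (by linarith) hp.le) (by positivity), hθ]
          congr 2
          ring
  have := norm_sub_sub_le_of_riemannSum_bound hu huv hYu hYv
    (R := f (Y u) (X v - X u)) (B := C * (K * η ^ ε) * (V v - V u) ^ θ) ?_
  · simpa using this
  intro t m n ht hmn hm hn
  subst hm hn
  exact norm_sum_sub_le_of_almost_additive (V := fun i => V (t i))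
    (Ξ := fun i j => f (Y (t i)) (X (t j) - X (t i))) hθ0
    (mul_nonneg hK (Real.rpow_nonneg hη0 _)) hC hCθ
    (fun i j hi hij hj => hVm _ _ (ht hi) (ht hij) (ht hj))
    (fun i j k hi hij hjk hk => defect _ _ _ (ht hi) (ht hij) (ht hjk) (ht hk))
    m n le_rfl hmn le_rfl

/-- A path whose small increments are bounded by arbitrarily small multiples of those of a
fixed function is constant. -/
theorem eq_of_forall_norm_sub_le_mul {E : Type*} [NormedAddCommGroup E] {G : ℝ → E}
    {V : ℝ → ℝ} {t : ℝ} (ht : 0 ≤ t)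
    (h : ∀ κ > 0, ∃ δ > 0, ∀ u v, 0 ≤ u → u ≤ v → v ≤ t → v - u < δ →
      ‖G v - G u‖ ≤ κ * (V v - V u)) : G t = G 0 := by
  have bound : ∀ κ > 0, ‖G t - G 0‖ ≤ κ * (V t - V 0) := by
    intro κ hκ
    obtain ⟨δ, hδ, H⟩ := h κ hκ
    obtain ⟨n, hn⟩ := exists_nat_gt (t / δ)
    have hn0 : (0 : ℝ) < n := (div_nonneg ht hδ.le).trans_lt hn
    have hstep : t / n < δ := by rwa [div_lt_comm₀ hn0 hδ]
    have ind : ∀ i : ℕ, i ≤ n → ‖G (i * (t / n)) - G 0‖ ≤ κ * (V (i * (t / n)) - V 0) := by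
      intro i
      induction i with
      | zero => simp
      | succ i ih =>
        intro hi
        have hq : 0 ≤ t / n := by positivity
        have hle : ((i + 1 : ℕ) : ℝ) * (t / n) ≤ t := by
          calc ((i + 1 : ℕ) : ℝ) * (t / n) ≤ n * (t / n) := by gcongr
            _ = t := by field_simp
        have hs := H (i * (t / n)) ((i + 1 : ℕ) * (t / n)) (by positivity)
          (by push_cast; linarith) hle (by push_cast; linarith)
        have := norm_sub_le_norm_sub_add_norm_sub (G ((i + 1 : ℕ) * (t / n)))
          (G (i * (t / n))) (G 0)
        linarith [ih (by omega)]
    have := ind n le_rfl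
    rwa [mul_div_cancel₀ t hn0.ne'] at this
  have hlim : Tendsto (fun κ : ℝ => κ * (V t - V 0)) (𝓝[>] 0) (𝓝 0) := by
    have : Tendsto (fun κ : ℝ => κ * (V t - V 0)) (𝓝 0) (𝓝 (0 * (V t - V 0))) :=
      tendsto_id.mul_const _
    rw [zero_mul] at this
    exact this.mono_left nhdsWithin_le_nhds
  have : ‖G t - G 0‖ ≤ 0 := ge_of_tendsto hlim (by
    filter_upwards [self_mem_nhdsWithin] with κ hκ using bound κ hκ)
  exact sub_eq_zero.mp (norm_le_zero_iff.mp this)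

/-- If `DF·f = 0`, then `F` is a conserved quantity of the Young equation `dY = f(Y)dX`:
for every solution `Y`, `F(Y_t) = F(Y_0)` for all `t ∈ [0,T]`. -/
theorem conserved_quantity_young
    {E₁ E₂ E₃ : Type*} [NormedAddCommGroup E₁] [NormedSpace ℝ E₁] [CompleteSpace E₁]
    [NormedAddCommGroup E₂] [NormedSpace ℝ E₂] [CompleteSpace E₂]
    [NormedAddCommGroup E₃] [NormedSpace ℝ E₃] [CompleteSpace E₃]
    (p γ T : ℝ) (hp1 : 1 ≤ p) (hp2 : p < 2) (hγ0 : 0 < γ) (hγ1 : γ ≤ 1)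
    (hγp : 1 + γ > p) (hT : 0 ≤ T)
    (X : ℝ → E₂) (hX : MemVp p X 0 T)
    (f : E₁ → E₂ →L[ℝ] E₁)
    (hf : ∃ C : ℝ, ∀ x y : E₁, ‖f x - f y‖ ≤ C * ‖x - y‖ ^ γ)
    (F : E₁ → E₃) (hF : ContDiff ℝ 2 F)
    (hDF : ∀ (y : E₁) (e : E₂), fderiv ℝ F y (f y e) = 0)
    (Y : ℝ → E₁) (hY : MemVp p Y 0 T)
    (hYeq : ∀ t ∈ Set.Icc (0 : ℝ) T, IsYoungIntegral (fun s => f (Y s)) X 0 t (Y t - Y 0)) :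
    ∀ t ∈ Set.Icc (0 : ℝ) T, F (Y t) = F (Y 0) := by
  intro t ht
  have hp : 0 < p := by linarith
  obtain ⟨VX, hVX⟩ := exists_control_of_memVp hp hX
  obtain ⟨VY, hVY⟩ := exists_control_of_memVp hp hY
  obtain ⟨K₀, hK₀⟩ := hf
  set K := max K₀ 0
  have hK : ∀ x y, ‖f x - f y‖ ≤ K * ‖x - y‖ ^ γ := fun x y => (hK₀ x y).trans (by
    gcongr
    exact le_max_left _ _)
  set V : ℝ → ℝ := fun s => VX s + VY s
  have hVXn : ∀ a b, 0 ≤ a → a ≤ b → b ≤ T → 0 ≤ VX b - VX a := fun a b ha hab hb =>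
    (Real.rpow_nonneg (norm_nonneg _) _).trans (hVX a b ha hab hb)
  have hVYn : ∀ a b, 0 ≤ a → a ≤ b → b ≤ T → 0 ≤ VY b - VY a := fun a b ha hab hb =>
    (Real.rpow_nonneg (norm_nonneg _) _).trans (hVY a b ha hab hb)
  have hVX' : ∀ a b, 0 ≤ a → a ≤ b → b ≤ T → ‖X b - X a‖ ^ p ≤ V b - V a :=
    fun a b ha hab hb => by
      simp only [V]; linarith [hVX a b ha hab hb, hVYn a b ha hab hb]
  have hVY' : ∀ a b, 0 ≤ a → a ≤ b → b ≤ T → ‖Y b - Y a‖ ^ p ≤ V b - V a :=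
    fun a b ha hab hb => by
      simp only [V]; linarith [hVY a b ha hab hb, hVXn a b ha hab hb]
  have hVm : ∀ a b, 0 ≤ a → a ≤ b → b ≤ T → 0 ≤ V b - V a := fun a b ha hab hb =>
    (Real.rpow_nonneg (norm_nonneg _) _).trans (hVX' a b ha hab hb)
  obtain ⟨L, M, hL0, hM0, hLM⟩ :=
    hF.exists_taylor_bound_on_compact (isCompact_Icc.image_of_continuousOn hY.1)
  set ε := (1 + γ - p) / 2 with hε
  set θ := (1 + γ - ε) / p with hθ
  have hε0 : 0 < ε := by rw [hε]; linarith
  have hεγ : ε ≤ γ := by rw [hε]; linarith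
  have hθ1 : 1 < θ := by rw [hθ, one_lt_div hp, hε]; linarith
  have hhalf : 2 * (1 / 2 : ℝ) ^ θ < 1 := by
    have := Real.rpow_lt_rpow_of_exponent_gt (x := 1 / 2) (by norm_num) (by norm_num) hθ1
    rw [Real.rpow_one] at this
    linarith
  set C := 2 / (1 - 2 * (1 / 2 : ℝ) ^ θ) with hCdef
  have hC0 : 0 ≤ C := div_nonneg (by norm_num) (by linarith)
  have hCθ : 2 * (C * (1 / 2) ^ θ) + 2 ≤ C := by
    have : C * (1 - 2 * (1 / 2 : ℝ) ^ θ) = 2 := div_mul_cancel₀ _ (by linarith)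
    linarith
  set A := M * (C * K) * (V T - V 0) ^ (θ - 1)
  have hcoef : Tendsto (fun η : ℝ => L * η ^ (2 - p) + A * η ^ ε) (𝓝[>] 0) (𝓝 0) := by
    have h1 : ∀ s : ℝ, 0 < s → Tendsto (fun η : ℝ => η ^ s) (𝓝[>] 0) (𝓝 0) := by
      intro s hs
      have := (Real.continuousAt_rpow_const 0 s (Or.inr hs.le)).tendsto
      rw [Real.zero_rpow hs.ne'] at this
      exact this.mono_left nhdsWithin_le_nhds
    simpa using ((h1 _ (sub_pos.mpr hp2)).const_mul L).add ((h1 _ hε0).const_mul A)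
  refine eq_of_forall_norm_sub_le_mul (G := fun s => F (Y s)) (V := V) ht.1 fun κ hκ => ?_
  obtain ⟨η, hηκ, hη⟩ := ((hcoef.eventually_lt_const hκ).and self_mem_nhdsWithin).exists
  have hη : 0 < η := hη
  obtain ⟨δ, hδ, hosc⟩ := Metric.uniformContinuousOn_iff.mp
    (isCompact_Icc.uniformContinuousOn_of_continuous hY.1) η hη
  refine ⟨δ, hδ, fun u v hu huv hvt hδuv => ?_⟩
  have hvT : v ≤ T := hvt.trans ht.2
  have hoscY : ∀ a b, u ≤ a → a ≤ b → b ≤ v → ‖Y b - Y a‖ ≤ η := fun a b ha hab hb => by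
    rw [← dist_eq_norm]
    refine (hosc b ⟨by linarith, by linarith⟩ a ⟨by linarith, by linarith⟩ ?_).le
    rw [Real.dist_eq, abs_of_nonneg (by linarith)]
    linarith
  have hinc := norm_increment_sub_le hp hε0.le hεγ hθ (le_max_right _ _) hC0 hCθ hK hu huv
    (fun a b ha hab hb => hVX' a b (hu.trans ha) hab (hb.trans hvT))
    (fun a b ha hab hb => hVY' a b (hu.trans ha) hab (hb.trans hvT)) hoscY
    (hYeq u ⟨hu, huv.trans hvT⟩) (hYeq v ⟨hu.trans huv, hvT⟩)
  obtain ⟨hMu, hLu⟩ := hLM (Y u) (mem_image_of_mem Y ⟨hu, huv.trans hvT⟩)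
  have hLuv := hLu (Y v) (mem_image_of_mem Y ⟨hu.trans huv, hvT⟩)
  have hW := hVm u v hu huv hvT
  have hsq : ‖Y v - Y u‖ ^ 2 ≤ η ^ (2 - p) * (V v - V u) := by
    have h2p : 0 ≤ 2 - p := by linarith
    calc ‖Y v - Y u‖ ^ 2 = ‖Y v - Y u‖ ^ (2 - p) * ‖Y v - Y u‖ ^ p := by
          rw [← Real.rpow_add_of_nonneg (norm_nonneg _) h2p hp.le, sub_add_cancel,
            Real.rpow_two]
      _ ≤ η ^ (2 - p) * (V v - V u) := by
          gcongr
          · exact hoscY u v le_rfl huv le_rfl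
          · exact hVY' u v hu huv hvT
  have hWθ : (V v - V u) ^ θ ≤ (V T - V 0) ^ (θ - 1) * (V v - V u) := by
    have hle : V v - V u ≤ V T - V 0 := by
      linarith [hVm 0 u le_rfl hu (huv.trans hvT), hVm v T (hu.trans huv) hvT le_rfl]
    calc (V v - V u) ^ θ = (V v - V u) ^ (θ - 1) * (V v - V u) := by
          nth_rewrite 3 [← Real.rpow_one (V v - V u)]
          rw [← Real.rpow_add_of_nonneg hW (by linarith) zero_le_one, sub_add_cancel]
      _ ≤ _ := by gcongr
  have hlin : ‖fderiv ℝ F (Y u) (Y v - Y u)‖ ≤ A * η ^ ε * (V v - V u) := by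
    have e : fderiv ℝ F (Y u) (Y v - Y u) =
        fderiv ℝ F (Y u) (Y v - Y u - f (Y u) (X v - X u)) := by
      rw [map_sub _ (Y v - Y u), hDF, sub_zero]
    rw [e]
    calc _ ≤ ‖fderiv ℝ F (Y u)‖ * ‖Y v - Y u - f (Y u) (X v - X u)‖ :=
          ContinuousLinearMap.le_opNorm _ _
      _ ≤ M * (C * (K * η ^ ε) * ((V T - V 0) ^ (θ - 1) * (V v - V u))) := by
          gcongr
          refine hinc.trans ?_
          gcongr
      _ = A * η ^ ε * (V v - V u) := by ring
  calc ‖F (Y v) - F (Y u)‖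
      = ‖(F (Y v) - F (Y u) - fderiv ℝ F (Y u) (Y v - Y u)) + fderiv ℝ F (Y u) (Y v - Y u)‖ := by
        rw [sub_add_cancel]
    _ ≤ L * (η ^ (2 - p) * (V v - V u)) + A * η ^ ε * (V v - V u) :=
        (norm_add_le _ _).trans (add_le_add (hLuv.trans (by gcongr)) hlin)
    _ = (L * η ^ (2 - p) + A * η ^ ε) * (V v - V u) := by ring
    _ ≤ κ * (V v - V u) := by gcongr
end
end
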